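/- Let Ω ⊂⊂ ℂⁿ be a pseudoconvex domain with smooth boundary and ρ a defining function of Ω; write N := N_ρ. For each (1,0) tangent vector field L on ∂Ω, extended to U so that Lρ = 0 on U, set Σ_L := {p ∈ ∂Ω : L_ρ(L,L)(p) = 0}. For a smooth real-valued function ψ on U, define η_ψ as the infimum of all η₂ ∈ (1,∞) such that for every such L the inequality (1/(η₂−1) + 1)·| L_ρ(L,N)/‖∇ρ‖ + (1/2)(Lψ) |² − ( |L_ρ(L,N)|²/‖∇ρ‖² + (1/2)·(N L_ρ(L,L))/‖∇ρ‖ ) − (1/4)·L_ψ(L,L) ≤ 0 holds at every point of Σ_L (η_ψ := ∞ if no such η₂ exists). Then S(Ω) equals the infimum of η_ψ over all smooth real-valued functions ψ on U. -/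

import Mathlib

noncomputable section

open Complex Topology
open scoped ENNReal

/-- Wirtinger derivative `∂f/∂z_j`. -/
def dz {n : ℕ} (j : Fin n) (f : (Fin n → ℂ) → ℂ) (z : Fin n → ℂ) : ℂ :=
  (fderiv ℝ f z (Pi.single j 1) - Complex.I * fderiv ℝ f z (Pi.single j Complex.I)) / 2

/-- Wirtinger derivative `∂f/∂z̄_j`. -/
def dzbar {n : ℕ} (j : Fin n) (f : (Fin n → ℂ) → ℂ) (z : Fin n → ℂ) : ℂ :=
  (fderiv ℝ f z (Pi.single j 1) + Complex.I * fderiv ℝ f z (Pi.single j Complex.I)) / 2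

/-- Complexification of a real-valued function. -/
def cplx {n : ℕ} (ρ : (Fin n → ℂ) → ℝ) : (Fin n → ℂ) → ℂ := fun z => (ρ z : ℂ)

/-- The Levi form `L_ρ(X,Y)(z) = Σ_{j,k} ∂²ρ/∂z_j∂z̄_k (z) X_j conj(Y_k)`. -/
def levi {n : ℕ} (ρ : (Fin n → ℂ) → ℝ) (X Y : Fin n → ℂ) (z : Fin n → ℂ) : ℂ :=
  ∑ j, ∑ k, dz j (fun w => dzbar k (cplx ρ) w) z * X j * (starRingEnd ℂ) (Y k)

/-- `Xf = Σ_j X_j ∂f/∂z_j` for a (1,0) vector `X`. -/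
def dirDeriv {n : ℕ} (X : Fin n → ℂ) (f : (Fin n → ℂ) → ℂ) (z : Fin n → ℂ) : ℂ :=
  ∑ j, X j * dz j f z

/-- `X̄f = Σ_j conj(X_j) ∂f/∂z̄_j`. -/
def dirDerivBar {n : ℕ} (X : Fin n → ℂ) (f : (Fin n → ℂ) → ℂ) (z : Fin n → ℂ) : ℂ :=
  ∑ j, (starRingEnd ℂ) (X j) * dzbar j f z

/-- Derivative of `f` along the (1,0) vector field `X`. -/
def fieldDeriv {n : ℕ} (X : (Fin n → ℂ) → (Fin n → ℂ)) (f : (Fin n → ℂ) → ℂ)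
    (z : Fin n → ℂ) : ℂ :=
  dirDeriv (X z) f z

/-- Euclidean norm of the real gradient of `ρ`. -/
def gradNorm {n : ℕ} (ρ : (Fin n → ℂ) → ℝ) (z : Fin n → ℂ) : ℝ :=
  Real.sqrt (∑ j, ((fderiv ℝ ρ z (Pi.single j 1)) ^ 2 +
    (fderiv ℝ ρ z (Pi.single j Complex.I)) ^ 2))

/-- The complex normal field `N_ρ`. -/
def nfield {n : ℕ} (ρ : (Fin n → ℂ) → ℝ) (z : Fin n → ℂ) : Fin n → ℂ := fun j =>
  ((Real.sqrt (∑ k, Complex.normSq (dz k (cplx ρ) z)) : ℝ) : ℂ)⁻¹ * dzbar j (cplx ρ) z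

/-- Squared Euclidean norm of a vector in ℂⁿ. -/
def enormSq {n : ℕ} (X : Fin n → ℂ) : ℝ := ∑ j, Complex.normSq (X j)

/-- `f` is strictly plurisubharmonic on `S`. -/
def StrictPSHOn {n : ℕ} (f : (Fin n → ℂ) → ℝ) (S : Set (Fin n → ℂ)) : Prop :=
  ∀ z ∈ S, ∀ X : Fin n → ℂ, X ≠ 0 → 0 < (levi f X X z).re

/-- `ρ` is a (global smooth) defining function of `Ω` on the neighborhood `V` of `cl Ω`. -/
structure IsDefFn {n : ℕ} (Ω V : Set (Fin n → ℂ)) (ρ : (Fin n → ℂ) → ℝ) : Prop where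
  isOpen : IsOpen V
  subset : closure Ω ⊆ V
  smooth : ContDiffOn ℝ (⊤ : ℕ∞) ρ V
  eq : Ω = {z ∈ V | ρ z < 0}
  grad_ne : ∀ z ∈ frontier Ω, fderiv ℝ ρ z ≠ 0

/-- The Levi form of `ρ` is positive semidefinite on complex tangent vectors at `z`. -/
def LeviPseudoconvexAt {n : ℕ} (ρ : (Fin n → ℂ) → ℝ) (z : Fin n → ℂ) : Prop :=
  ∀ X : Fin n → ℂ, dirDeriv X (cplx ρ) z = 0 → 0 ≤ (levi ρ X X z).re

/-- `Ω` is a (smoothly bounded, Levi) pseudoconvex domain. -/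
def IsPseudoconvex {n : ℕ} (Ω : Set (Fin n → ℂ)) : Prop :=
  ∃ (V : Set (Fin n → ℂ)) (ρ : (Fin n → ℂ) → ℝ), IsDefFn Ω V ρ ∧
    ∀ p ∈ frontier Ω, LeviPseudoconvexAt ρ p

/-- The set of Steinness exponents of `ρ`. -/
def steinExpSet {n : ℕ} (Ω : Set (Fin n → ℂ)) (ρ : (Fin n → ℂ) → ℝ) : Set ℝ :=
  {η : ℝ | 1 < η ∧ ∃ W : Set (Fin n → ℂ), IsOpen W ∧ frontier Ω ⊆ W ∧
    StrictPSHOn (fun z => ρ z ^ η) ((closure Ω)ᶜ ∩ W)}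

/-- The Steinness exponent `η̃_ρ` of a defining function `ρ` (`∞` if none exists). -/
def steinExp {n : ℕ} (Ω : Set (Fin n → ℂ)) (ρ : (Fin n → ℂ) → ℝ) : ℝ≥0∞ :=
  sInf (ENNReal.ofReal '' steinExpSet Ω ρ)

/-- The Steinness index `S(Ω)`. -/
def steinIndex {n : ℕ} (Ω : Set (Fin n → ℂ)) : ℝ≥0∞ :=
  ⨅ (V : Set (Fin n → ℂ)) (ρ : (Fin n → ℂ) → ℝ) (_ : IsDefFn Ω V ρ), steinExp Ω ρ

/-- The set of Diederich–Fornæss exponents of `ρ`. -/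
def dfExpSet {n : ℕ} (Ω : Set (Fin n → ℂ)) (ρ : (Fin n → ℂ) → ℝ) : Set ℝ :=
  {η : ℝ | 0 < η ∧ η < 1 ∧ StrictPSHOn (fun z => -((-ρ z) ^ η)) Ω}

/-- The Diederich–Fornæss exponent of `ρ` (`0` if no exponent exists). -/
def dfExp {n : ℕ} (Ω : Set (Fin n → ℂ)) (ρ : (Fin n → ℂ) → ℝ) : ℝ :=
  sSup (insert 0 (dfExpSet Ω ρ))

/-- The Diederich–Fornæss index `DF(Ω)`. -/
def dfIndex {n : ℕ} (Ω : Set (Fin n → ℂ)) : ℝ :=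
  sSup {t : ℝ | ∃ V ρ, IsDefFn Ω V ρ ∧ t = dfExp Ω ρ}

/-- `L` is a smooth (1,0) tangent vector field for `ρ` on `A`. -/
def IsTangentField {n : ℕ} (ρ : (Fin n → ℂ) → ℝ) (L : (Fin n → ℂ) → (Fin n → ℂ))
    (A : Set (Fin n → ℂ)) : Prop :=
  ContDiffOn ℝ (⊤ : ℕ∞) L A ∧ ∀ z ∈ A, dirDeriv (L z) (cplx ρ) z = 0

/-- The key differential inequality
`(1/(η₂−1))|L_ρ(L,N)|²/‖∇ρ‖² − (1/2)(N L_ρ(L,L))/‖∇ρ‖ ≤ 0` at `p`. -/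
def keyIneqAt {n : ℕ} (ρ : (Fin n → ℂ) → ℝ) (L : (Fin n → ℂ) → (Fin n → ℂ)) (η₂ : ℝ)
    (p : Fin n → ℂ) : Prop :=
  1 / (η₂ - 1) * Complex.normSq (levi ρ (L p) (nfield ρ p) p) / (gradNorm ρ p) ^ 2 -
    1 / 2 * (fieldDeriv (nfield ρ) (fun w => levi ρ (L w) (L w) w) p).re / gradNorm ρ p ≤ 0

/-- The strict version of the key differential inequality. -/
def strictKeyIneqAt {n : ℕ} (ρ : (Fin n → ℂ) → ℝ) (L : (Fin n → ℂ) → (Fin n → ℂ)) (η₂ : ℝ)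
    (p : Fin n → ℂ) : Prop :=
  1 / (η₂ - 1) * Complex.normSq (levi ρ (L p) (nfield ρ p) p) / (gradNorm ρ p) ^ 2 -
    1 / 2 * (fieldDeriv (nfield ρ) (fun w => levi ρ (L w) (L w) w) p).re / gradNorm ρ p < 0

/-- `cl Ω` has a strong Stein neighborhood basis. -/
def HasStrongSteinBasis {n : ℕ} (Ω : Set (Fin n → ℂ)) : Prop :=
  ∃ (V : Set (Fin n → ℂ)) (ρ : (Fin n → ℂ) → ℝ), IsDefFn Ω V ρ ∧ ∃ ε₀ : ℝ, 0 < ε₀ ∧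
    (∀ z ∈ V, 0 ≤ ρ z → ρ z < ε₀ → fderiv ℝ ρ z ≠ 0) ∧
    ∀ ε : ℝ, 0 ≤ ε → ε < ε₀ → ∀ z ∈ V, ρ z = ε → LeviPseudoconvexAt ρ z

/-- Vanishing order at `0` of a holomorphic function `ℂ → ℂ` (`∞` if all derivatives vanish). -/
def orderC (h : ℂ → ℂ) : ℕ∞ :=
  sInf ((fun k : ℕ => (k : ℕ∞)) '' {k : ℕ | iteratedDeriv k h 0 ≠ 0})

/-- Vanishing order at `0` of a real-valued function on `ℂ`. -/
def orderR (g : ℂ → ℝ) : ℕ∞ :=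
  sInf ((fun k : ℕ => (k : ℕ∞)) '' {k : ℕ | iteratedFDeriv ℝ k g 0 ≠ 0})

/-- `ν(γ)`: minimal vanishing order at `0` of the components of `γ − p`. -/
def curveOrder {n : ℕ} (γ : ℂ → Fin n → ℂ) (p : Fin n → ℂ) : ℕ∞ :=
  ⨅ j, orderC (fun t => γ t j - p j)

/-- `p` is a boundary point of finite D'Angelo 1-type (w.r.t. the defining function `ρ`). -/
def FiniteTypePt {n : ℕ} (ρ : (Fin n → ℂ) → ℝ) (p : Fin n → ℂ) : Prop :=
  ∃ M : ℕ, ∀ γ : ℂ → Fin n → ℂ, (∀ j, AnalyticAt ℂ (fun t => γ t j) 0) → γ 0 = p →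
    ¬ (∀ᶠ t in nhds (0 : ℂ), γ t = p) →
    orderR (fun t => ρ (γ t)) ≤ (M : ℕ∞) * curveOrder γ p

/-- The set of exponents `η₂ > 1` for which the inequality of Corollary 3.6 (with weight `ψ`)
holds on `Σ_L` for every (1,0) tangent vector field `L`. -/
def etaPsiSet {n : ℕ} (Ω U : Set (Fin n → ℂ)) (ρ ψ : (Fin n → ℂ) → ℝ) : Set ℝ :=
  {η₂ : ℝ | 1 < η₂ ∧ ∀ L : (Fin n → ℂ) → (Fin n → ℂ), IsTangentField ρ L U →
    ∀ p ∈ frontier Ω, levi ρ (L p) (L p) p = 0 →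
      (1 / (η₂ - 1) + 1) *
          Complex.normSq (levi ρ (L p) (nfield ρ p) p / (gradNorm ρ p : ℂ) +
            1 / 2 * dirDeriv (L p) (cplx ψ) p) -
        (Complex.normSq (levi ρ (L p) (nfield ρ p) p) / (gradNorm ρ p) ^ 2 +
          1 / 2 * (fieldDeriv (nfield ρ) (fun w => levi ρ (L w) (L w) w) p).re /
            gradNorm ρ p) -
        1 / 4 * (levi ψ (L p) (L p) p).re ≤ 0}

/-- `η_ψ` of the statement (`∞` if no admissible exponent exists). -/
def etaPsi {n : ℕ} (Ω U : Set (Fin n → ℂ)) (ρ ψ : (Fin n → ℂ) → ℝ) : ℝ≥0∞ :=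
  sInf (ENNReal.ofReal '' etaPsiSet Ω U ρ ψ)

section Wirtinger

open scoped ContDiff

variable {n : ℕ}

theorem hasFDerivAt_cplx {f : (Fin n → ℂ) → ℝ} {z : Fin n → ℂ} (hf : DifferentiableAt ℝ f z) :
    HasFDerivAt (cplx f) (Complex.ofRealCLM.comp (fderiv ℝ f z)) z :=
  Complex.ofRealCLM.hasFDerivAt.comp z hf.hasFDerivAt

theorem fderiv_cplx {f : (Fin n → ℂ) → ℝ} {z : Fin n → ℂ} (hf : DifferentiableAt ℝ f z)
    (v : Fin n → ℂ) : fderiv ℝ (cplx f) z v = (fderiv ℝ f z v : ℂ) := by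
  rw [(hasFDerivAt_cplx hf).fderiv]; simp

theorem dz_cplx {f : (Fin n → ℂ) → ℝ} {z : Fin n → ℂ} (hf : DifferentiableAt ℝ f z) (j : Fin n) :
    dz j (cplx f) z =
      ((fderiv ℝ f z (Pi.single j 1) : ℂ) - I * (fderiv ℝ f z (Pi.single j I) : ℂ)) / 2 := by
  rw [dz, fderiv_cplx hf, fderiv_cplx hf]

theorem dzbar_cplx {f : (Fin n → ℂ) → ℝ} {z : Fin n → ℂ} (hf : DifferentiableAt ℝ f z)
    (j : Fin n) :
    dzbar j (cplx f) z =
      ((fderiv ℝ f z (Pi.single j 1) : ℂ) + I * (fderiv ℝ f z (Pi.single j I) : ℂ)) / 2 := by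
  rw [dzbar, fderiv_cplx hf, fderiv_cplx hf]

theorem conj_dz_cplx {f : (Fin n → ℂ) → ℝ} {z : Fin n → ℂ} (hf : DifferentiableAt ℝ f z)
    (j : Fin n) : (starRingEnd ℂ) (dz j (cplx f) z) = dzbar j (cplx f) z := by
  rw [dz_cplx hf, dzbar_cplx hf]
  simp [Complex.conj_ofNat]

theorem dz_mul {u v : (Fin n → ℂ) → ℂ} {z : Fin n → ℂ} (hu : DifferentiableAt ℝ u z)
    (hv : DifferentiableAt ℝ v z) (j : Fin n) :
    dz j (fun w => u w * v w) z = dz j u z * v z + u z * dz j v z := by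
  simp only [dz, fderiv_fun_mul hu hv]
  simp only [add_apply, smul_apply, smul_eq_mul]
  ring

theorem dz_add {u v : (Fin n → ℂ) → ℂ} {z : Fin n → ℂ} (hu : DifferentiableAt ℝ u z)
    (hv : DifferentiableAt ℝ v z) (j : Fin n) :
    dz j (fun w => u w + v w) z = dz j u z + dz j v z := by
  simp only [dz, fderiv_fun_add hu hv, add_apply]
  ring

theorem dz_congr {u v : (Fin n → ℂ) → ℂ} {z : Fin n → ℂ} (h : u =ᶠ[𝓝 z] v) (j : Fin n) :
    dz j u z = dz j v z := by
  simp only [dz, h.fderiv_eq]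

theorem dzbar_congr {u v : (Fin n → ℂ) → ℂ} {z : Fin n → ℂ} (h : u =ᶠ[𝓝 z] v) (j : Fin n) :
    dzbar j u z = dzbar j v z := by
  simp only [dzbar, h.fderiv_eq]

theorem cplx_congr {f g : (Fin n → ℂ) → ℝ} {z : Fin n → ℂ} (h : f =ᶠ[𝓝 z] g) :
    cplx f =ᶠ[𝓝 z] cplx g :=
  h.mono fun w hw => by simp only [cplx, hw]

theorem levi_congr {f g : (Fin n → ℂ) → ℝ} {z : Fin n → ℂ} (h : f =ᶠ[𝓝 z] g)
    (X Y : Fin n → ℂ) : levi f X Y z = levi g X Y z := by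
  have : ∀ k, (fun w => dzbar k (cplx f) w) =ᶠ[𝓝 z] fun w => dzbar k (cplx g) w := fun k =>
    h.eventually_nhds.mono fun w hw => dzbar_congr (cplx_congr hw) k
  simp only [levi, dz_congr (this _)]

theorem dirDeriv_congr {f g : (Fin n → ℂ) → ℂ} {z : Fin n → ℂ} (h : f =ᶠ[𝓝 z] g)
    (X : Fin n → ℂ) : dirDeriv X f z = dirDeriv X g z := by
  simp only [dirDeriv, dz_congr h]

theorem fderiv_comp_real {f : (Fin n → ℂ) → ℝ} {g : ℝ → ℝ} {g' : ℝ} {z : Fin n → ℂ}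
    (hf : DifferentiableAt ℝ f z) (hg : HasDerivAt g g' (f z)) :
    HasFDerivAt (fun w => g (f w)) (g' • fderiv ℝ f z) z :=
  hg.comp_hasFDerivAt z hf.hasFDerivAt

theorem dz_comp_real {f : (Fin n → ℂ) → ℝ} {g : ℝ → ℝ} {g' : ℝ} {z : Fin n → ℂ}
    (hf : DifferentiableAt ℝ f z) (hg : HasDerivAt g g' (f z)) (j : Fin n) :
    dz j (cplx fun w => g (f w)) z = g' * dz j (cplx f) z := by
  have h := fderiv_comp_real hf hg
  rw [dz_cplx h.differentiableAt, dz_cplx hf, h.fderiv]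
  simp
  ring

theorem dzbar_comp_real {f : (Fin n → ℂ) → ℝ} {g : ℝ → ℝ} {g' : ℝ} {z : Fin n → ℂ}
    (hf : DifferentiableAt ℝ f z) (hg : HasDerivAt g g' (f z)) (j : Fin n) :
    dzbar j (cplx fun w => g (f w)) z = g' * dzbar j (cplx f) z := by
  have h := fderiv_comp_real hf hg
  rw [dzbar_cplx h.differentiableAt, dzbar_cplx hf, h.fderiv]
  simp
  ring

theorem dirDeriv_comp_real {f : (Fin n → ℂ) → ℝ} {g : ℝ → ℝ} {g' : ℝ} {z : Fin n → ℂ}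
    (hf : DifferentiableAt ℝ f z) (hg : HasDerivAt g g' (f z)) (X : Fin n → ℂ) :
    dirDeriv X (cplx fun w => g (f w)) z = g' * dirDeriv X (cplx f) z := by
  simp only [dirDeriv, dz_comp_real hf hg, Finset.mul_sum]
  exact Finset.sum_congr rfl fun j _ => by ring

theorem dirDeriv_cplx_add {f g : (Fin n → ℂ) → ℝ} {z : Fin n → ℂ}
    (hf : DifferentiableAt ℝ f z) (hg : DifferentiableAt ℝ g z) (X : Fin n → ℂ) :
    dirDeriv X (cplx fun w => f w + g w) z =
      dirDeriv X (cplx f) z + dirDeriv X (cplx g) z := by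
  have : (cplx fun w => f w + g w) = fun w => cplx f w + cplx g w := by
    funext w; simp [cplx]
  simp only [dirDeriv, this, dz_add (hasFDerivAt_cplx hf).differentiableAt
    (hasFDerivAt_cplx hg).differentiableAt, mul_add, Finset.sum_add_distrib]

theorem dirDeriv_add (X Y : Fin n → ℂ) (f : (Fin n → ℂ) → ℂ) (z : Fin n → ℂ) :
    dirDeriv (X + Y) f z = dirDeriv X f z + dirDeriv Y f z := by
  simp only [dirDeriv, Pi.add_apply, add_mul, Finset.sum_add_distrib]

theorem dirDeriv_smul (c : ℂ) (X : Fin n → ℂ) (f : (Fin n → ℂ) → ℂ) (z : Fin n → ℂ) :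
    dirDeriv (c • X) f z = c * dirDeriv X f z := by
  simp only [dirDeriv, Pi.smul_apply, smul_eq_mul, Finset.mul_sum, mul_assoc]

theorem levi_smul_left (c : ℂ) (f : (Fin n → ℂ) → ℝ) (X Y z : Fin n → ℂ) :
    levi f (c • X) Y z = c * levi f X Y z := by
  simp only [levi, Pi.smul_apply, smul_eq_mul, Finset.mul_sum]
  exact Finset.sum_congr rfl fun j _ => Finset.sum_congr rfl fun k _ => by ring

theorem levi_smul_right (c : ℂ) (f : (Fin n → ℂ) → ℝ) (X Y z : Fin n → ℂ) :
    levi f X (c • Y) z = (starRingEnd ℂ) c * levi f X Y z := by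
  simp only [levi, Pi.smul_apply, smul_eq_mul, Finset.mul_sum, map_mul]
  exact Finset.sum_congr rfl fun j _ => Finset.sum_congr rfl fun k _ => by ring

theorem levi_add_left (f : (Fin n → ℂ) → ℝ) (X X' Y z : Fin n → ℂ) :
    levi f (X + X') Y z = levi f X Y z + levi f X' Y z := by
  simp only [levi, Pi.add_apply, ← Finset.sum_add_distrib]
  exact Finset.sum_congr rfl fun j _ => Finset.sum_congr rfl fun k _ => by ring

theorem levi_add_right (f : (Fin n → ℂ) → ℝ) (X Y Y' z : Fin n → ℂ) :
    levi f X (Y + Y') z = levi f X Y z + levi f X Y' z := by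
  simp only [levi, Pi.add_apply, ← Finset.sum_add_distrib, map_add]
  exact Finset.sum_congr rfl fun j _ => Finset.sum_congr rfl fun k _ => by ring

theorem contDiffAt_cplx {m : WithTop ℕ∞} {f : (Fin n → ℂ) → ℝ} {z : Fin n → ℂ}
    (hf : ContDiffAt ℝ m f z) : ContDiffAt ℝ m (cplx f) z :=
  Complex.ofRealCLM.contDiff.contDiffAt.comp z hf

theorem contDiffAt_dz {m m' : WithTop ℕ∞} {f : (Fin n → ℂ) → ℂ} {z : Fin n → ℂ}
    (hf : ContDiffAt ℝ m f z) (hm : m' + 1 ≤ m) (j : Fin n) : ContDiffAt ℝ m' (dz j f) z := by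
  have h := hf.fderiv_right hm
  unfold dz
  exact ((h.clm_apply contDiffAt_const).sub
    (contDiffAt_const.mul (h.clm_apply contDiffAt_const))).div_const _

theorem contDiffAt_dzbar {m m' : WithTop ℕ∞} {f : (Fin n → ℂ) → ℂ} {z : Fin n → ℂ}
    (hf : ContDiffAt ℝ m f z) (hm : m' + 1 ≤ m) (j : Fin n) : ContDiffAt ℝ m' (dzbar j f) z := by
  have h := hf.fderiv_right hm
  unfold dzbar
  exact ((h.clm_apply contDiffAt_const).add
    (contDiffAt_const.mul (h.clm_apply contDiffAt_const))).div_const _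

theorem fderiv_dzbar_cplx {f : (Fin n → ℂ) → ℝ} {z : Fin n → ℂ} (hf : ContDiffAt ℝ 2 f z)
    (k : Fin n) (v : Fin n → ℂ) :
    fderiv ℝ (fun w => dzbar k (cplx f) w) z v =
      ((fderiv ℝ (fderiv ℝ f) z v (Pi.single k 1) : ℂ) +
        I * (fderiv ℝ (fderiv ℝ f) z v (Pi.single k I) : ℂ)) / 2 := by
  have h1 : (fun w => dzbar k (cplx f) w) =ᶠ[𝓝 z] fun w =>
      (cplx (fun w => fderiv ℝ f w (Pi.single k 1)) w +
        I * cplx (fun w => fderiv ℝ f w (Pi.single k I)) w) * (1 / 2) := by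
    filter_upwards [hf.eventually (by simp)] with w hw
    rw [dzbar_cplx (hw.differentiableAt (by simp))]
    simp only [cplx]
    ring
  have h2 : DifferentiableAt ℝ (fderiv ℝ f) z :=
    (hf.fderiv_right (m := 1) (by norm_num)).differentiableAt (by simp)
  have h3 : ∀ e : Fin n → ℂ, HasFDerivAt (fun w => fderiv ℝ f w e)
      ((ContinuousLinearMap.apply ℝ ℝ e).comp (fderiv ℝ (fderiv ℝ f) z)) z := fun e =>
    (ContinuousLinearMap.apply ℝ ℝ e).hasFDerivAt.comp z h2.hasFDerivAt
  have h4 := fun e => hasFDerivAt_cplx (h3 e).differentiableAt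
  rw [h1.fderiv_eq, (((h4 (Pi.single k 1)).fun_add ((h4 (Pi.single k I)).const_mul I)).mul_const
    (1 / 2)).fderiv, (h3 _).fderiv, (h3 _).fderiv]
  simp
  ring

theorem conj_dz_dzbar_cplx {f : (Fin n → ℂ) → ℝ} {z : Fin n → ℂ} (hf : ContDiffAt ℝ 2 f z)
    (j k : Fin n) : (starRingEnd ℂ) (dz j (fun w => dzbar k (cplx f) w) z) =
      dz k (fun w => dzbar j (cplx f) w) z := by
  have hs : IsSymmSndFDerivAt ℝ f z := hf.isSymmSndFDerivAt (by simp)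
  simp only [dz, fderiv_dzbar_cplx hf]
  rw [hs (Pi.single k 1) (Pi.single j 1), hs (Pi.single k 1) (Pi.single j I),
    hs (Pi.single k I) (Pi.single j 1), hs (Pi.single k I) (Pi.single j I)]
  simp [Complex.conj_ofNat]
  ring

theorem conj_levi {f : (Fin n → ℂ) → ℝ} {z : Fin n → ℂ} (hf : ContDiffAt ℝ 2 f z)
    (X Y : Fin n → ℂ) : (starRingEnd ℂ) (levi f X Y z) = levi f Y X z := by
  simp only [levi, map_sum, map_mul, conj_dz_dzbar_cplx hf, Complex.conj_conj]
  rw [Finset.sum_comm]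
  exact Finset.sum_congr rfl fun j _ => Finset.sum_congr rfl fun k _ => by ring

theorem levi_self_im {f : (Fin n → ℂ) → ℝ} {z : Fin n → ℂ} (hf : ContDiffAt ℝ 2 f z)
    (X : Fin n → ℂ) : (levi f X X z).im = 0 :=
  Complex.conj_eq_iff_im.1 (conj_levi hf X X)

theorem levi_self_add_re {f : (Fin n → ℂ) → ℝ} {z : Fin n → ℂ} (hf : ContDiffAt ℝ 2 f z)
    (X Y : Fin n → ℂ) (c : ℂ) : (levi f (X + c • Y) (X + c • Y) z).re =
      (levi f X X z).re + 2 * ((starRingEnd ℂ) c * levi f X Y z).re +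
        normSq c * (levi f Y Y z).re := by
  rw [levi_add_left, levi_add_right, levi_add_right, levi_smul_left, levi_smul_left,
    levi_smul_right, levi_smul_right, ← conj_levi hf X Y]
  simp [Complex.normSq_apply]
  ring

theorem levi_cplx_add {f g : (Fin n → ℂ) → ℝ} {z : Fin n → ℂ}
    (hf : ContDiffAt ℝ 2 f z) (hg : ContDiffAt ℝ 2 g z) (X Y : Fin n → ℂ) :
    levi (fun w => f w + g w) X Y z = levi f X Y z + levi g X Y z := by
  have h2 : (2 : WithTop ℕ∞) ≠ 0 := by simp
  have h : ∀ k, (fun w => dzbar k (cplx fun w => f w + g w) w) =ᶠ[𝓝 z]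
      fun w => dzbar k (cplx f) w + dzbar k (cplx g) w := by
    intro k
    filter_upwards [hf.eventually (by simp), hg.eventually (by simp)] with w hfw hgw
    have hf' := hfw.differentiableAt h2
    have hg' := hgw.differentiableAt h2
    rw [dzbar_cplx hf', dzbar_cplx hg', dzbar_cplx (hf'.fun_add hg'), fderiv_fun_add hf' hg']
    simp
    ring
  have hd : ∀ {u : (Fin n → ℂ) → ℝ} (k : Fin n), ContDiffAt ℝ 2 u z →
      DifferentiableAt ℝ (fun w => dzbar k (cplx u) w) z := fun k hu =>
    (contDiffAt_dzbar (m' := 1) (contDiffAt_cplx hu) (by norm_num) k).differentiableAt (by simp)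
  simp only [levi, dz_congr (h _), dz_add (hd _ hf) (hd _ hg), ← Finset.sum_add_distrib]
  exact Finset.sum_congr rfl fun j _ => Finset.sum_congr rfl fun k _ => by ring

theorem sum_dz_mul_dzbar {f : (Fin n → ℂ) → ℝ} {z : Fin n → ℂ} (hf : DifferentiableAt ℝ f z)
    (X : Fin n → ℂ) :
    ∑ j, ∑ k, dz j (cplx f) z * dzbar k (cplx f) z * X j * (starRingEnd ℂ) (X k) =
      normSq (dirDeriv X (cplx f) z) := by
  rw [← Complex.mul_conj]
  simp only [dirDeriv, map_sum, map_mul, conj_dz_cplx hf, Finset.sum_mul_sum]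
  exact Finset.sum_congr rfl fun j _ => Finset.sum_congr rfl fun k _ => by ring

theorem levi_comp_real {f : (Fin n → ℂ) → ℝ} {g g' : ℝ → ℝ} {g'' : ℝ} {z : Fin n → ℂ}
    (hf : ContDiffAt ℝ 2 f z) (hg : ∀ᶠ t in 𝓝 (f z), HasDerivAt g (g' t) t)
    (hg' : HasDerivAt g' g'' (f z)) (X : Fin n → ℂ) :
    levi (fun w => g (f w)) X X z =
      g'' * normSq (dirDeriv X (cplx f) z) + g' (f z) * levi f X X z := by
  have h2 : (2 : WithTop ℕ∞) ≠ 0 := by simp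
  have hfd := hf.differentiableAt h2
  have h : ∀ k, (fun w => dzbar k (cplx fun w => g (f w)) w) =ᶠ[𝓝 z]
      fun w => cplx (fun w => g' (f w)) w * dzbar k (cplx f) w := by
    intro k
    filter_upwards [hf.eventually (by simp), hf.continuousAt.eventually hg] with w hfw hgw
    rw [dzbar_comp_real (hfw.differentiableAt h2) hgw, cplx]
  have hd : ∀ k : Fin n, DifferentiableAt ℝ (fun w => dzbar k (cplx f) w) z := fun k =>
    (contDiffAt_dzbar (m' := 1) (contDiffAt_cplx hf) (by norm_num) k).differentiableAt (by simp)
  have hd' : DifferentiableAt ℝ (cplx fun w => g' (f w)) z :=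
    (hasFDerivAt_cplx (fderiv_comp_real hfd hg').differentiableAt).differentiableAt
  rw [← sum_dz_mul_dzbar hfd]
  simp only [levi, dz_congr (h _), dz_mul hd' (hd _), dz_comp_real hfd hg', Finset.mul_sum,
    ← Finset.sum_add_distrib]
  refine Finset.sum_congr rfl fun j _ => Finset.sum_congr rfl fun k _ => ?_
  simp only [cplx]
  ring

theorem contDiffAt_dirDeriv {F : Type*} [NormedAddCommGroup F] [NormedSpace ℝ F]
    {f : (Fin n → ℂ) → ℂ} {X ζ : F → Fin n → ℂ} {q : F} (hf : ContDiffAt ℝ ∞ f (ζ q))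
    (hX : ContDiffAt ℝ ∞ X q) (hζ : ContDiffAt ℝ ∞ ζ q) :
    ContDiffAt ℝ ∞ (fun x => dirDeriv (X x) f (ζ x)) q := by
  unfold dirDeriv
  exact ContDiffAt.sum fun j _ =>
    (contDiffAt_pi.1 hX j).mul ((contDiffAt_dz hf (by simp) j).comp q hζ)

theorem contDiffAt_levi {F : Type*} [NormedAddCommGroup F] [NormedSpace ℝ F]
    {f : (Fin n → ℂ) → ℝ} {X Y ζ : F → Fin n → ℂ} {q : F} (hf : ContDiffAt ℝ ∞ f (ζ q))
    (hX : ContDiffAt ℝ ∞ X q) (hY : ContDiffAt ℝ ∞ Y q) (hζ : ContDiffAt ℝ ∞ ζ q) :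
    ContDiffAt ℝ ∞ (fun x => levi f (X x) (Y x) (ζ x)) q := by
  unfold levi
  refine ContDiffAt.sum fun j _ => ContDiffAt.sum fun k _ => ?_
  have h1 : ContDiffAt ℝ ∞ (dz j fun w => dzbar k (cplx f) w) (ζ q) :=
    contDiffAt_dz (m := ∞) (contDiffAt_dzbar (contDiffAt_cplx hf) (by simp) k) (by simp) j
  exact ((h1.comp q hζ).mul (contDiffAt_pi.1 hX j)).mul
    (Complex.conjCLE.contDiff.contDiffAt.comp q (contDiffAt_pi.1 hY k))

end Wirtinger

section LeviExpansion

open scoped ContDiff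

variable {n : ℕ}

/-- The complex gradient `Σ_j (∂ρ/∂z̄_j) ∂/∂z_j`. -/
def cgrad (ρ : (Fin n → ℂ) → ℝ) (z : Fin n → ℂ) : Fin n → ℂ := fun j => dzbar j (cplx ρ) z

/-- The squared length `Σ_j |∂ρ/∂z_j|²` of the complex gradient. -/
def gradSq (ρ : (Fin n → ℂ) → ℝ) (z : Fin n → ℂ) : ℝ := ∑ k, normSq (dz k (cplx ρ) z)

/-- A denominator-free projection of the vector `Y` to the complex tangent space of `ρ`. -/
def tproj (ρ : (Fin n → ℂ) → ℝ) (Y z : Fin n → ℂ) : Fin n → ℂ :=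
  (gradSq ρ z : ℂ) • Y - dirDeriv Y (cplx ρ) z • cgrad ρ z

/-- The Levi form of `(ρ e^ψ)^η` divided by `η (ρ e^ψ)^η`, where `ρ > 0`. -/
def logLevi (η : ℝ) (ρ ψ : (Fin n → ℂ) → ℝ) (X z : Fin n → ℂ) : ℝ :=
  (levi ρ X X z).re / ρ z - normSq (dirDeriv X (cplx ρ) z) / ρ z ^ 2 + (levi ψ X X z).re +
    η * normSq (dirDeriv X (cplx ρ) z / ρ z + dirDeriv X (cplx ψ) z)

/-- Coefficient of `|c|²` in `logLevi` of `M + c ρ ∂̄ρ`, for `M` tangent. -/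
def coefA (η : ℝ) (ρ ψ : (Fin n → ℂ) → ℝ) (z : Fin n → ℂ) : ℝ :=
  ρ z * (levi ρ (cgrad ρ z) (cgrad ρ z) z).re - gradSq ρ z ^ 2 +
    ρ z ^ 2 * (levi ψ (cgrad ρ z) (cgrad ρ z) z).re +
    η * normSq (gradSq ρ z + ρ z * dirDeriv (cgrad ρ z) (cplx ψ) z)

/-- Coefficient of the term linear in `c` in `logLevi` of `M + c ρ ∂̄ρ`, for `M` tangent. -/
def coefB (η : ℝ) (ρ ψ : (Fin n → ℂ) → ℝ) (M z : Fin n → ℂ) : ℂ :=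
  levi ρ M (cgrad ρ z) z + ρ z * levi ψ M (cgrad ρ z) z +
    η * (starRingEnd ℂ) (gradSq ρ z + ρ z * dirDeriv (cgrad ρ z) (cplx ψ) z) *
      dirDeriv M (cplx ψ) z

/-- Bounded part of the constant term in `logLevi` of `M + c ρ ∂̄ρ`, for `M` tangent. -/
def coefC (η : ℝ) (ψ : (Fin n → ℂ) → ℝ) (M z : Fin n → ℂ) : ℝ :=
  (levi ψ M M z).re + η * normSq (dirDeriv M (cplx ψ) z)

/-- `ρ` times the minimum over `c` of `logLevi` of `M + c ρ ∂̄ρ`, where `M = tproj ρ Y z`. -/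
def barrier (η : ℝ) (ρ ψ : (Fin n → ℂ) → ℝ) (Y z : Fin n → ℂ) : ℝ :=
  (levi ρ (tproj ρ Y z) (tproj ρ Y z) z).re +
    ρ z * (coefC η ψ (tproj ρ Y z) z -
      normSq (coefB η ρ ψ (tproj ρ Y z) z) / coefA η ρ ψ z)

theorem dirDeriv_cgrad {ρ : (Fin n → ℂ) → ℝ} {z : Fin n → ℂ} (hρ : DifferentiableAt ℝ ρ z) :
    dirDeriv (cgrad ρ z) (cplx ρ) z = gradSq ρ z := by
  simp only [dirDeriv, cgrad, gradSq, ofReal_sum, normSq_eq_conj_mul_self, conj_dz_cplx hρ]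

theorem dirDeriv_sub (X Y : Fin n → ℂ) (f : (Fin n → ℂ) → ℂ) (z : Fin n → ℂ) :
    dirDeriv (X - Y) f z = dirDeriv X f z - dirDeriv Y f z := by
  simp only [dirDeriv, Pi.sub_apply, sub_mul, Finset.sum_sub_distrib]

theorem dirDeriv_tproj {ρ : (Fin n → ℂ) → ℝ} {z : Fin n → ℂ} (hρ : DifferentiableAt ℝ ρ z)
    (Y : Fin n → ℂ) : dirDeriv (tproj ρ Y z) (cplx ρ) z = 0 := by
  rw [tproj, dirDeriv_sub, dirDeriv_smul, dirDeriv_smul, dirDeriv_cgrad hρ]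
  ring

theorem tproj_of_tangent {ρ : (Fin n → ℂ) → ℝ} {Y z : Fin n → ℂ}
    (hY : dirDeriv Y (cplx ρ) z = 0) : tproj ρ Y z = (gradSq ρ z : ℂ) • Y := by
  simp [tproj, hY]

theorem gradSq_nonneg (ρ : (Fin n → ℂ) → ℝ) (z : Fin n → ℂ) : 0 ≤ gradSq ρ z :=
  Finset.sum_nonneg fun _ _ => normSq_nonneg _

theorem eq_sum_single (X : Fin n → ℂ) :
    X = ∑ j, ((X j).re • (Pi.single j 1 : Fin n → ℂ) + (X j).im • (Pi.single j I : Fin n → ℂ)) := by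
  funext i
  simp [Finset.sum_apply, Pi.single_apply, Finset.sum_add_distrib]

theorem re_dirDeriv_cplx {f : (Fin n → ℂ) → ℝ} {z : Fin n → ℂ} (hf : DifferentiableAt ℝ f z)
    (X : Fin n → ℂ) : 2 * (dirDeriv X (cplx f) z).re = fderiv ℝ f z X := by
  conv_rhs => rw [eq_sum_single X]
  simp only [dirDeriv, dz_cplx hf, map_sum, map_add, map_smul, re_sum, Finset.mul_sum, smul_eq_mul]
  refine Finset.sum_congr rfl fun j _ => ?_
  rw [mul_div_assoc']
  simp
  ring

theorem gradSq_pos {ρ : (Fin n → ℂ) → ℝ} {z : Fin n → ℂ} (hρ : DifferentiableAt ℝ ρ z)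
    (h : fderiv ℝ ρ z ≠ 0) : 0 < gradSq ρ z := by
  refine lt_of_le_of_ne (gradSq_nonneg ρ z) fun h0 => h ?_
  have h1 : ∀ k, dz k (cplx ρ) z = 0 := fun k => normSq_eq_zero.1
    ((Finset.sum_eq_zero_iff_of_nonneg fun _ _ => normSq_nonneg _).1 h0.symm k (Finset.mem_univ k))
  ext X
  rw [← re_dirDeriv_cplx hρ X]
  simp [dirDeriv, h1]

theorem fderiv_cgrad {ρ : (Fin n → ℂ) → ℝ} {z : Fin n → ℂ} (hρ : DifferentiableAt ℝ ρ z) :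
    fderiv ℝ ρ z (cgrad ρ z) = 2 * gradSq ρ z := by
  rw [← re_dirDeriv_cplx hρ, dirDeriv_cgrad hρ, ofReal_re]

theorem gradNorm_eq {ρ : (Fin n → ℂ) → ℝ} {z : Fin n → ℂ} (hρ : DifferentiableAt ℝ ρ z) :
    gradNorm ρ z = 2 * √(gradSq ρ z) := by
  have h4 : (2 : ℝ) = √(2 ^ 2) := by rw [Real.sqrt_sq (by norm_num)]
  rw [gradNorm, h4, ← Real.sqrt_mul (by norm_num), gradSq, Finset.mul_sum]
  congr 1
  refine Finset.sum_congr rfl fun j _ => ?_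
  rw [dz_cplx hρ]
  simp [Complex.normSq_apply]
  ring

theorem nfield_eq {ρ : (Fin n → ℂ) → ℝ} {z : Fin n → ℂ} :
    nfield ρ z = ((√(gradSq ρ z) : ℝ) : ℂ)⁻¹ • cgrad ρ z := by
  funext j; simp [nfield, gradSq, cgrad]

theorem levi_rpow_mul_exp {η : ℝ} {ρ ψ F : (Fin n → ℂ) → ℝ} {z : Fin n → ℂ}
    (hρ : ContDiffAt ℝ 2 ρ z) (hψ : ContDiffAt ℝ 2 ψ z) (hz : 0 < ρ z)
    (hF : F =ᶠ[𝓝 z] fun w => (ρ w * Real.exp (ψ w)) ^ η) (X : Fin n → ℂ) :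
    (levi F X X z).re = η * F z * logLevi η ρ ψ X z := by
  have h2 : (2 : WithTop ℕ∞) ≠ 0 := by simp
  have hlog : ContDiffAt ℝ 2 (fun w => Real.log (ρ w)) z := hρ.log hz.ne'
  have hF' : F =ᶠ[𝓝 z] fun w => Real.exp (η * (Real.log (ρ w) + ψ w)) := by
    filter_upwards [hF, hρ.continuousAt.eventually (lt_mem_nhds hz)] with w hw hw0
    rw [hw, Real.rpow_def_of_pos (mul_pos hw0 (Real.exp_pos _)),
      Real.log_mul (ne_of_gt hw0) (Real.exp_pos _).ne', Real.log_exp, mul_comm]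
  have hg : ∀ t : ℝ, HasDerivAt (fun t => Real.exp (η * t)) (η * Real.exp (η * t)) t := fun t => by
    simpa [mul_comm] using ((hasDerivAt_id t).const_mul η).exp
  have hg' : ∀ t : ℝ, HasDerivAt (fun t => η * Real.exp (η * t)) (η * (η * Real.exp (η * t))) t :=
    fun t => (hg t).const_mul η
  have hl : ∀ᶠ t in 𝓝 (ρ z), HasDerivAt Real.log t⁻¹ t := by
    filter_upwards [lt_mem_nhds hz] with t ht using Real.hasDerivAt_log (ne_of_gt ht)
  rw [levi_congr hF', levi_comp_real (g' := fun t => η * Real.exp (η * t)) (hlog.add hψ)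
    (Filter.Eventually.of_forall hg) (hg' _), levi_cplx_add hlog hψ, levi_comp_real hρ hl
    (hasDerivAt_inv hz.ne'), dirDeriv_cplx_add (hlog.differentiableAt h2) (hψ.differentiableAt h2),
    dirDeriv_comp_real (hρ.differentiableAt h2) hl.self_of_nhds, hF'.self_of_nhds, logLevi]
  have h5 : ((ρ z)⁻¹ : ℝ) * dirDeriv X (cplx ρ) z = dirDeriv X (cplx ρ) z / ρ z := by
    push_cast; rw [inv_mul_eq_div]
  rw [h5]
  simp only [add_re, re_ofReal_mul, ofReal_re]
  field_simp
  ring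

theorem logLevi_add_smul_cgrad {η : ℝ} {ρ ψ : (Fin n → ℂ) → ℝ} {z M : Fin n → ℂ}
    (hρ : ContDiffAt ℝ 2 ρ z) (hψ : ContDiffAt ℝ 2 ψ z) (hz : 0 < ρ z)
    (hM : dirDeriv M (cplx ρ) z = 0) (c : ℂ) :
    logLevi η ρ ψ (M + (c * ρ z) • cgrad ρ z) z =
      (levi ρ M M z).re / ρ z + (coefA η ρ ψ z * normSq c +
        2 * ((starRingEnd ℂ) c * coefB η ρ ψ M z).re + coefC η ψ M z) := by
  have h2 : (2 : WithTop ℕ∞) ≠ 0 := by simp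
  have hz' : (ρ z : ℂ) ≠ 0 := ofReal_ne_zero.2 hz.ne'
  rw [logLevi, levi_self_add_re hρ, levi_self_add_re hψ, dirDeriv_add, dirDeriv_add, hM,
    dirDeriv_smul, dirDeriv_smul, dirDeriv_cgrad (hρ.differentiableAt h2), coefA, coefB, coefC]
  generalize levi ρ M (cgrad ρ z) z = B₁
  generalize levi ψ M (cgrad ρ z) z = B₂
  generalize (levi ρ (cgrad ρ z) (cgrad ρ z) z).re = A₁
  generalize (levi ψ (cgrad ρ z) (cgrad ρ z) z).re = A₂
  generalize dirDeriv M (cplx ψ) z = d₁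
  generalize dirDeriv (cgrad ρ z) (cplx ψ) z = d₂
  have h3 : (0 + c * ρ z * (gradSq ρ z : ℂ)) / ρ z = c * gradSq ρ z := by field_simp; ring
  rw [h3]
  simp only [normSq_apply, add_re, add_im, mul_re, mul_im, ofReal_re, ofReal_im, conj_re, conj_im,
    map_mul, map_add, zero_re, zero_im]
  field_simp
  ring

theorem quadratic_ge {a : ℝ} (ha : 0 < a) (b c : ℂ) :
    -(normSq b / a) ≤ a * normSq c + 2 * ((starRingEnd ℂ) c * b).re := by
  have h : 0 ≤ normSq (a * c + b) / a := div_nonneg (normSq_nonneg _) ha.le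
  have : normSq (a * c + b) / a =
      a * normSq c + 2 * ((starRingEnd ℂ) c * b).re + normSq b / a := by
    simp only [normSq_apply, add_re, add_im, mul_re, mul_im, ofReal_re, ofReal_im, conj_re, conj_im]
    field_simp
    ring
  linarith

theorem quadratic_min {a : ℝ} (ha : a ≠ 0) (b : ℂ) :
    a * normSq (-b / a) + 2 * ((starRingEnd ℂ) (-b / a) * b).re = -(normSq b / a) := by
  have : (-b / a : ℂ) = ((-a⁻¹ : ℝ) : ℂ) * b := by push_cast; ring
  rw [this]
  simp only [normSq_apply, mul_re, mul_im, ofReal_re, ofReal_im, map_mul, conj_re, conj_im]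
  field_simp
  ring

theorem coefA_of_eq_zero {η : ℝ} {ρ ψ : (Fin n → ℂ) → ℝ} {z : Fin n → ℂ} (hz : ρ z = 0) :
    coefA η ρ ψ z = (η - 1) * gradSq ρ z ^ 2 := by
  simp only [coefA, hz, ofReal_zero, zero_mul, add_zero, normSq_ofReal]
  ring

theorem coefB_of_eq_zero {η : ℝ} {ρ ψ : (Fin n → ℂ) → ℝ} {z : Fin n → ℂ} (hz : ρ z = 0)
    (M : Fin n → ℂ) : coefB η ρ ψ M z =
      levi ρ M (cgrad ρ z) z + η * gradSq ρ z * dirDeriv M (cplx ψ) z := by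
  simp only [coefB, hz, ofReal_zero, zero_mul, add_zero, conj_ofReal]

theorem complete_square {η s κ l : ℝ} (hη : 1 < η) (hs : 0 < s) (B b : ℂ) :
    κ + (l + η * normSq b) - normSq (B + η * s * b) / ((η - 1) * s ^ 2) =
      -4 * ((1 / (η - 1) + 1) * normSq (B / (2 * s) + 1 / 2 * b) -
        (normSq B / (4 * s ^ 2) + κ / 4) - 1 / 4 * l) := by
  have h1 : η - 1 ≠ 0 := by linarith
  have h3 : B / (2 * s) + 1 / 2 * b = ((1 / (2 * s) : ℝ) : ℂ) * (B + s * b) := by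
    have : (s : ℂ) ≠ 0 := ofReal_ne_zero.2 hs.ne'
    push_cast; field_simp
  rw [h3]
  simp only [normSq_apply, add_re, add_im, mul_re, mul_im, ofReal_re, ofReal_im]
  field_simp
  ring

theorem exists_perturbation {k k' R : ℝ} (hk' : 0 < k') (hk : k' < k) :
    ∃ ε : ℝ, 0 < ε ∧ ∀ (A B : ℂ) (m : ℝ), 0 < m → normSq B ≤ R * m →
      k' * normSq (A + 1 / 2 * (ε * B)) < k * normSq A + 1 / 4 * (ε * m) := by
  have hd : 0 < k - k' := by linarith
  have hk0 : 0 < k := by linarith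
  set K := k' * k / (k - k') with hK
  have hKpos : 0 < K := by positivity
  refine ⟨1 / (K * (|R| + 1)), by positivity, fun A B m hm hB => ?_⟩
  set ε := 1 / (K * (|R| + 1)) with hε
  have hε0 : 0 < ε := by positivity
  have h1 : k' * normSq (A + 1 / 2 * (ε * B)) ≤ k * normSq A + K * ε ^ 2 / 4 * normSq B := by
    have h0 : 0 ≤ normSq (((k - k' : ℝ) : ℂ) * A - ((k' * ε / 2 : ℝ) : ℂ) * B) / (k - k') :=
      div_nonneg (normSq_nonneg _) hd.le
    have : normSq (((k - k' : ℝ) : ℂ) * A - ((k' * ε / 2 : ℝ) : ℂ) * B) / (k - k') =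
        k * normSq A + K * ε ^ 2 / 4 * normSq B - k' * normSq (A + 1 / 2 * (ε * B)) := by
      have e : (A + 1 / 2 * (ε * B)) = A + ((ε / 2 : ℝ) : ℂ) * B := by push_cast; ring
      rw [e, hK]
      clear_value ε
      simp only [normSq_apply, add_re, add_im, sub_re, sub_im, mul_re, mul_im, ofReal_re,
        ofReal_im]
      field_simp
      ring
    linarith
  have h2 : normSq B < (|R| + 1) * m :=
    hB.trans_lt (mul_lt_mul_of_pos_right (by linarith [le_abs_self R]) hm)
  have h3 : K * ε ^ 2 / 4 * normSq B < K * ε ^ 2 / 4 * ((|R| + 1) * m) :=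
    mul_lt_mul_of_pos_left h2 (by positivity)
  have h4 : K * ε ^ 2 / 4 * ((|R| + 1) * m) = 1 / 4 * (ε * m) := by
    rw [hε]; field_simp
  linarith

end LeviExpansion

section SmoothDivision

open scoped ContDiff

theorem exists_contDiff_eq_nhdsSet {E : Type*} [NormedAddCommGroup E] [NormedSpace ℝ E]
    [FiniteDimensional ℝ E] {m : ℕ∞} {K U : Set E} {f : E → ℝ} (hK : IsClosed K) (hU : IsOpen U)
    (hKU : K ⊆ U) (hf : ∀ z ∈ U, ContDiffAt ℝ m f z) :
    ∃ g : E → ℝ, ContDiff ℝ m g ∧ (∀ᶠ z in 𝓝ˢ K, g z = f z) ∧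
      ∀ z, (z ∈ U → f z = 0) → g z = 0 := by
  obtain ⟨χ, h0, h1, -⟩ := exists_contMDiffMap_zero_one_nhds_of_isClosed (n := m)
    (modelWithCornersSelf ℝ E) hU.isClosed_compl hK
    (Set.disjoint_left.2 fun z hz hzK => hz (hKU hzK))
  have hχ : ContDiff ℝ m χ := χ.contMDiff.contDiff
  refine ⟨fun z => χ z * f z, contDiff_iff_contDiffAt.2 fun z => ?_, ?_, fun z hz => ?_⟩
  · by_cases hz : z ∈ U
    · exact hχ.contDiffAt.mul (hf z hz)
    · have : (fun z => χ z * f z) =ᶠ[𝓝 z] fun _ => 0 := by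
        filter_upwards [nhds_le_nhdsSet (Set.mem_compl hz) h0] with w hw
        rw [hw, zero_mul]
      exact contDiffAt_const.congr_of_eventuallyEq this
  · filter_upwards [h1] with z hz
    rw [hz, one_mul]
  · by_cases hzU : z ∈ U
    · simp [hz hzU]
    · simp [h0.self_of_nhdsSet z hzU]

theorem contDiff_intervalIntegral {E : Type} [NormedAddCommGroup E] [NormedSpace ℝ E]
    [FiniteDimensional ℝ E] (m : ℕ) : ∀ {F : Type} [NormedAddCommGroup F] [NormedSpace ℝ F]
    [CompleteSpace F] {g : E × ℝ → F} (_ : ContDiff ℝ m g) (a b : ℝ),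
      ContDiff ℝ m fun x => ∫ s in a..b, g (x, s) := by
  induction m with
  | zero =>
    intro F _ _ _ g hg a b
    exact contDiff_zero.2 (intervalIntegral.continuous_parametric_intervalIntegral_of_continuous'
      (f := fun x s => g (x, s)) (by exact hg.continuous) a b)
  | succ m ih =>
    intro F _ _ _ g hg a b
    have hg' : ContDiff ℝ (m + 1) g := by exact_mod_cast hg
    set g' : E × ℝ → E →L[ℝ] F := fun q =>
      (fderiv ℝ g q).comp (ContinuousLinearMap.inl ℝ E ℝ) with hg'def
    have hg'c : ContDiff ℝ m g' := (hg'.fderiv_right le_rfl).clm_comp contDiff_const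
    have hd : ∀ x s, HasFDerivAt (fun x => g (x, s)) (g' (x, s)) x := fun x s =>
      (hg'.differentiable (by simp) (x, s)).hasFDerivAt.comp x
        (hasFDerivAt_prodMk_left x s)
    have : ContDiff ℝ (m + 1 : ℕ) fun x => ∫ s in a..b, g (x, s) := by
      push_cast
      refine contDiff_succ_iff_hasFDerivAt.2 ⟨_, ih hg'c a b, fun x => ?_⟩
      obtain ⟨C, hC⟩ := ((isCompact_closedBall x 1).prod (isCompact_uIcc (a := a) (b := b)))
        |>.exists_bound_of_continuousOn hg'c.continuous.continuousOn
      have hc : ∀ y, Continuous fun s : ℝ => g (y, s) := fun y =>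
        hg.continuous.comp (Continuous.prodMk_right y)
      refine intervalIntegral.hasFDerivAt_integral_of_dominated_of_fderiv_le
        (F := fun x s => g (x, s)) (F' := fun x s => g' (x, s)) (bound := fun _ => C)
        (Metric.closedBall_mem_nhds x one_pos)
        (Filter.Eventually.of_forall fun y => (hc y).aestronglyMeasurable)
        ((hc x).intervalIntegrable _ _)
        (hg'c.continuous.comp (Continuous.prodMk_right x)).aestronglyMeasurable
        (Filter.Eventually.of_forall fun s hs y hy => hC _ ⟨hy, Set.uIoc_subset_uIcc hs⟩)
        intervalIntegrable_const
        (Filter.Eventually.of_forall fun s _ y _ => hd y s)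
    exact this

theorem exists_contDiff_mul_eq {E : Type} [NormedAddCommGroup E] [NormedSpace ℝ E]
    [FiniteDimensional ℝ E] {m : ℕ} {F : E → ℝ} (hF : ContDiff ℝ (m + 1) F) (ℓ : E →L[ℝ] ℝ) {w : E}
    (hw : ℓ w = 1) (p : E) (h0 : ∀ x, ℓ (x - p) = 0 → F x = 0) :
    ∃ H : E → ℝ, ContDiff ℝ m H ∧ ∀ x, F x = ℓ (x - p) * H x := by
  have hF' : ContDiff ℝ m (fderiv ℝ F) := hF.fderiv_right le_rfl
  refine ⟨fun x => ∫ s in (0 : ℝ)..1, fderiv ℝ F (x - (s * ℓ (x - p)) • w) w,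
    contDiff_intervalIntegral m
      (g := fun q : E × ℝ => fderiv ℝ F (q.1 - (q.2 * ℓ (q.1 - p)) • w) w) ?_ 0 1, fun x => ?_⟩
  · refine (hF'.comp ?_).clm_apply contDiff_const
    fun_prop
  · have hd : ∀ s : ℝ, HasDerivAt (fun s : ℝ => F (x - (s * ℓ (x - p)) • w))
        (fderiv ℝ F (x - (s * ℓ (x - p)) • w) (-(ℓ (x - p) • w))) s := fun s => by
      have h1 : HasDerivAt (fun s : ℝ => x - (s * ℓ (x - p)) • w) (-(ℓ (x - p) • w)) s := by
        simpa using (((hasDerivAt_id s).mul_const (ℓ (x - p))).smul_const w).const_sub x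
      exact (hF.differentiable (by simp) _).hasFDerivAt.comp_hasDerivAt s h1
    have hc : Continuous fun s : ℝ =>
        fderiv ℝ F (x - (s * ℓ (x - p)) • w) (-(ℓ (x - p) • w)) :=
      (hF'.continuous.comp (by fun_prop)).clm_apply continuous_const
    have h2 := intervalIntegral.integral_eq_sub_of_hasDerivAt (fun s _ => hd s)
      (hc.intervalIntegrable 0 1)
    have h3 : F (x - (1 * ℓ (x - p)) • w) = 0 := h0 _ (by simp [hw])
    simp only [map_neg, map_smul, smul_eq_mul, intervalIntegral.integral_neg,
      intervalIntegral.integral_const_mul, h3] at h2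
    simp at h2
    simp only [map_sub]
    exact h2.symm

theorem exists_contDiffAt_mul_eq {E : Type} [NormedAddCommGroup E] [NormedSpace ℝ E]
    [FiniteDimensional ℝ E] {m : ℕ} {ρ f : E → ℝ} {p : E} (hρ : ContDiffAt ℝ (m + 1) ρ p)
    (hf : ContDiffAt ℝ (m + 1) f p) (hp : ρ p = 0) (hd : fderiv ℝ ρ p ≠ 0)
    (h0 : ∀ᶠ z in 𝓝 p, ρ z = 0 → f z = 0) :
    ∃ H : E → ℝ, ContDiffAt ℝ m H p ∧ ∀ᶠ z in 𝓝 p, f z = ρ z * H z := by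
  set ℓ := fderiv ℝ ρ p with hℓ
  obtain ⟨w₀, hw₀⟩ : ∃ w, ℓ w ≠ 0 := by
    by_contra! h
    exact hd (ContinuousLinearMap.ext h)
  set w := (ℓ w₀)⁻¹ • w₀ with hwdef
  have hw : ℓ w = 1 := by simp [hwdef, hw₀]
  have hm : ((m : WithTop ℕ∞) + 1) ≠ 0 := by simp
  set Ψ : E → E := fun z => z + (ρ z - ℓ (z - p)) • w with hΨ
  have hΨs : ContDiffAt ℝ (m + 1) Ψ p := by
    have : ContDiffAt ℝ (m + 1) (fun z => ℓ (z - p)) p := by fun_prop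
    exact contDiffAt_id.add ((hρ.sub this).smul contDiffAt_const)
  have hΨd : HasFDerivAt Ψ ((ContinuousLinearEquiv.refl ℝ E : E ≃L[ℝ] E) : E →L[ℝ] E) p := by
    have h1 : HasFDerivAt (fun z => ℓ (z - p)) ℓ p :=
      ℓ.hasFDerivAt.comp p ((hasFDerivAt_id p).sub_const p)
    have h2 := (hasFDerivAt_id p).add (((hρ.differentiableAt hm).hasFDerivAt.sub h1).smul_const w)
    refine h2.congr_fderiv ?_
    ext v
    simp [hℓ]
  have hΨp : Ψ p = p := by simp [hΨ, hp]
  have hℓΨ : ∀ z, ℓ (Ψ z - p) = ρ z := fun z => by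
    have : Ψ z - p = (z - p) + (ρ z - ℓ (z - p)) • w := by simp only [hΨ]; abel
    rw [this, map_add, map_smul, hw]
    simp
  have hst := hΨs.hasStrictFDerivAt' hΨd hm
  set Θ := hΨs.localInverse hΨd hm with hΘ
  have hΘs : ContDiffAt ℝ (m + 1) Θ p := by
    have := hΨs.to_localInverse hΨd hm
    rwa [hΨp] at this
  have hΘp : Θ p = p := by
    have := hΨs.localInverse_apply_image hΨd hm
    rwa [hΨp] at this
  have hright : ∀ᶠ x in 𝓝 p, Ψ (Θ x) = x := by
    have := hst.eventually_right_inverse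
    rwa [hΨp] at this
  have hleft : ∀ᶠ z in 𝓝 p, Θ (Ψ z) = z := hst.eventually_left_inverse
  have hFs : ContDiffAt ℝ (m + 1) (f ∘ Θ) p := ContDiffAt.comp p (by rwa [hΘp]) hΘs
  have hev : ∀ᶠ x in 𝓝 p, ContDiffAt ℝ (m + 1) (f ∘ Θ) x ∧ (ℓ (x - p) = 0 → f (Θ x) = 0) := by
    have hΘc : Filter.Tendsto Θ (𝓝 p) (𝓝 p) := by
      have := hΘs.continuousAt
      rwa [ContinuousAt, hΘp] at this
    filter_upwards [hFs.eventually (by simp), hright, hΘc.eventually h0] with x h1 h2 h3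
    exact ⟨h1, fun h => h3 (by rw [← hℓΨ, h2, h])⟩
  obtain ⟨S, hS, hSo, hpS⟩ := eventually_nhds_iff.1 hev
  obtain ⟨G, hG, hGeq, hG0⟩ := exists_contDiff_eq_nhdsSet (m := (m + 1 : ℕ)) (f := f ∘ Θ)
    isClosed_singleton hSo (Set.singleton_subset_iff.2 hpS)
    (fun z hz => by exact_mod_cast (hS z hz).1)
  obtain ⟨H, hH, hHeq⟩ := exists_contDiff_mul_eq (m := m) (F := G) (by exact_mod_cast hG) ℓ hw p
    fun x hx => hG0 x fun hxS => (hS x hxS).2 hx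
  refine ⟨H ∘ Ψ, hH.contDiffAt.comp p (hΨs.of_le (by simp)), ?_⟩
  rw [nhdsSet_singleton] at hGeq
  have hΨc : Filter.Tendsto Ψ (𝓝 p) (𝓝 p) := by
    have := hΨs.continuousAt
    rwa [ContinuousAt, hΨp] at this
  filter_upwards [hleft, hΨc.eventually hGeq] with z h1 h2
  rw [Function.comp_apply, ← hℓΨ z, ← hHeq, h2, Function.comp_apply, h1]

end SmoothDivision

section DefiningFunctions

open scoped ContDiff

theorem eventually_pos_add_smul {E : Type*} [NormedAddCommGroup E] [NormedSpace ℝ E] {f : E → ℝ}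
    {p v : E} (hf : DifferentiableAt ℝ f p) (h0 : f p = 0) (hv : 0 < fderiv ℝ f p v) :
    ∀ᶠ t in 𝓝[>] (0 : ℝ), 0 < f (p + t • v) := by
  have hl : HasDerivAt (fun t : ℝ => p + t • v) v 0 := by
    simpa using ((hasDerivAt_id (0 : ℝ)).smul_const v).const_add p
  have hd : HasDerivAt (fun t : ℝ => f (p + t • v)) (fderiv ℝ f p v) 0 :=
    HasFDerivAt.comp_hasDerivAt (0 : ℝ) (by simpa using hf.hasFDerivAt) hl
  have h1 := (hd.tendsto_slope.mono_left (nhdsGT_le_nhdsNE 0)).eventually (lt_mem_nhds hv)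
  filter_upwards [h1, self_mem_nhdsWithin] with t h2 h3
  have h3' : (0 : ℝ) < t := h3
  rw [slope_def_field] at h2
  simp only [zero_smul, add_zero, h0, sub_zero] at h2
  exact (div_pos_iff_of_pos_right h3').1 h2

theorem eventually_pos_of_fderiv_pos {E : Type*} [NormedAddCommGroup E] [NormedSpace ℝ E]
    {h r : E → ℝ} {p v : E} (hh : ContDiffAt ℝ 1 h p) (hr : ContDiffAt ℝ 1 r p) (hp : r p = 0)
    (hrv : 0 < fderiv ℝ r p v) (hhv : 0 < fderiv ℝ h p v)
    (hnn : ∀ᶠ x in 𝓝 p, r x = 0 → 0 ≤ h x) : ∀ᶠ x in 𝓝 p, 0 < r x → 0 < h x := by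
  have hc : Filter.Tendsto (fun x => fderiv ℝ h x v) (𝓝 p) (𝓝 (fderiv ℝ h p v)) :=
    ((hh.fderiv_right (m := 0) (by simp)).clm_apply contDiffAt_const).continuousAt
  have hev : ∀ᶠ x in 𝓝 p, DifferentiableAt ℝ h x ∧ ContinuousAt r x ∧ 0 < fderiv ℝ h x v ∧
      (r x = 0 → 0 ≤ h x) := by
    filter_upwards [hh.eventually (by simp), hr.eventually (by simp),
      hc.eventually (lt_mem_nhds hhv), hnn] with x h1 h2 h3 h4
    exact ⟨h1.differentiableAt (by simp), h2.continuousAt, h3, h4⟩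
  obtain ⟨δ, hδ, hball⟩ := Metric.eventually_nhds_iff_ball.1 hev
  have hneg : ∀ᶠ t in 𝓝[>] (0 : ℝ), 0 < -r (p + t • -v) := by
    refine eventually_pos_add_smul (f := fun x => -r x) (hr.differentiableAt (by simp)).neg
      (by simp [hp]) ?_
    rw [fderiv_fun_neg]
    simpa using hrv
  have hin : ∀ᶠ t in 𝓝[>] (0 : ℝ), p + t • -v ∈ Metric.ball p δ := by
    have : Filter.Tendsto (fun t : ℝ => p + t • -v) (𝓝 0) (𝓝 p) := by
      have h : Continuous fun t : ℝ => p + t • -v := by fun_prop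
      simpa using h.tendsto 0
    exact (this.eventually (Metric.ball_mem_nhds p hδ)).filter_mono nhdsWithin_le_nhds
  obtain ⟨t, ⟨ht1, ht2⟩, ht0⟩ := ((hneg.and hin).and self_mem_nhdsWithin).exists
  have ht0 : 0 < t := ht0
  have hsh : ContinuousAt (fun x : E => x + t • -v) p := by fun_prop
  have hrt : ContinuousAt r (p + t • -v) := (hball _ ht2).2.1
  have e1 : ∀ᶠ x in 𝓝 p, r (x + t • -v) < 0 :=
    (ContinuousAt.comp (f := fun x : E => x + t • -v) hrt hsh).eventually
      (gt_mem_nhds (by simpa using ht1))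
  have e2 : ∀ᶠ x in 𝓝 p, x + t • -v ∈ Metric.ball p δ :=
    hsh.eventually (Metric.isOpen_ball.mem_nhds ht2)
  filter_upwards [e1, e2, Metric.ball_mem_nhds p hδ] with x h1 h2 h3 h4
  have hseg : ∀ s ∈ Set.Icc 0 t, x + s • -v ∈ Metric.ball p δ := by
    intro s hs
    have := (convex_ball p δ).add_smul_sub_mem h3 h2 (t := s / t)
      ⟨div_nonneg hs.1 ht0.le, (div_le_one ht0).2 hs.2⟩
    rwa [add_sub_cancel_left, smul_smul, div_mul_cancel₀ _ ht0.ne'] at this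
  have hline : ∀ s : ℝ, HasDerivAt (fun s : ℝ => x + s • -v) (-v) s := fun s => by
    simpa using ((hasDerivAt_id s).smul_const (-v)).const_add x
  have hcr : ContinuousOn (fun s : ℝ => r (x + s • -v)) (Set.Icc 0 t) := fun s hs =>
    (ContinuousAt.comp (f := fun s : ℝ => x + s • -v) (hball _ (hseg s hs)).2.1
      (hline s).continuousAt).continuousWithinAt
  obtain ⟨s, hs, hs0⟩ := intermediate_value_Icc' ht0.le hcr (show (0 : ℝ) ∈ Set.Icc _ _ from
    ⟨h1.le, by simpa using h4.le⟩)
  have hs0 : r (x + s • -v) = 0 := hs0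
  have hspos : 0 < s := by
    refine lt_of_le_of_ne hs.1 fun h => h4.ne' ?_
    simpa [← h] using hs0
  have hdh : ∀ u ∈ Set.Icc 0 s, HasDerivAt (fun s : ℝ => h (x + s • -v))
      (fderiv ℝ h (x + u • -v) (-v)) u := fun u hu =>
    (hball _ (hseg u ⟨hu.1, hu.2.trans hs.2⟩)).1.hasFDerivAt.comp_hasDerivAt u (hline u)
  have hanti : StrictAntiOn (fun s : ℝ => h (x + s • -v)) (Set.Icc 0 s) := by
    refine strictAntiOn_of_deriv_neg (convex_Icc 0 s)
      (fun u hu => (hdh u hu).continuousAt.continuousWithinAt) fun u hu => ?_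
    have hu' := interior_subset hu
    rw [(hdh u hu').deriv, map_neg, neg_lt_zero]
    exact (hball _ (hseg u ⟨hu'.1, hu'.2.trans hs.2⟩)).2.2.1
  have := hanti (Set.left_mem_Icc.2 hspos.le) (Set.right_mem_Icc.2 hspos.le) hspos
  simp only [zero_smul, add_zero] at this
  exact ((hball _ (hseg s hs)).2.2.2 hs0).trans_lt this

variable {n : ℕ} {Ω V : Set (Fin n → ℂ)} {ρ : (Fin n → ℂ) → ℝ} {z : Fin n → ℂ}

theorem IsDefFn.contDiffAt (h : IsDefFn Ω V ρ) (hz : z ∈ V) : ContDiffAt ℝ ∞ ρ z :=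
  (h.smooth z hz).contDiffAt (h.isOpen.mem_nhds hz)

theorem IsDefFn.frontier_subset (h : IsDefFn Ω V ρ) : frontier Ω ⊆ V :=
  frontier_subset_closure.trans h.subset

theorem IsDefFn.nonpos (h : IsDefFn Ω V ρ) (hz : z ∈ closure Ω) : ρ z ≤ 0 := by
  by_contra! hlt
  have h1 : ∀ᶠ w in 𝓝 z, 0 < ρ w :=
    (h.contDiffAt (h.subset hz)).continuousAt.eventually (lt_mem_nhds hlt)
  obtain ⟨w, hw, hw'⟩ := (mem_closure_iff_frequently.1 hz |>.and_eventually h1).exists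
  rw [h.eq] at hw
  exact absurd hw.2 (not_lt.2 hw'.le)

theorem IsDefFn.eq_zero (h : IsDefFn Ω V ρ) (hΩ : IsOpen Ω) (hz : z ∈ frontier Ω) : ρ z = 0 := by
  refine le_antisymm (h.nonpos (frontier_subset_closure hz)) (not_lt.1 fun hlt => ?_)
  rw [hΩ.frontier_eq] at hz
  exact hz.2 (by rw [h.eq]; exact ⟨h.subset hz.1, hlt⟩)

theorem IsDefFn.mem_frontier (h : IsDefFn Ω V ρ) (hΩ : IsOpen Ω) (hz : z ∈ V) (h0 : ρ z = 0)
    (hd : fderiv ℝ ρ z ≠ 0) : z ∈ frontier Ω := by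
  have hnot : z ∉ Ω := by
    rw [h.eq]
    exact fun hz' => absurd hz'.2 (by simp [h0])
  obtain ⟨v, hv⟩ : ∃ v, 0 < fderiv ℝ (fun x => -ρ x) z v := by
    by_contra! hle
    refine hd (ContinuousLinearMap.ext fun v => le_antisymm ?_ ?_)
    · simpa [fderiv_fun_neg] using hle (-v)
    · simpa [fderiv_fun_neg] using hle v
  have h1 := eventually_pos_add_smul (f := fun x => -ρ x)
    ((h.contDiffAt hz).differentiableAt (by simp)).neg (by simp [h0]) hv
  have h2 : Filter.Tendsto (fun t : ℝ => z + t • v) (𝓝[>] 0) (𝓝 z) := by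
    have : Continuous fun t : ℝ => z + t • v := by fun_prop
    simpa using (this.tendsto 0).mono_left nhdsWithin_le_nhds
  refine hΩ.frontier_eq ▸ ⟨mem_closure_of_tendsto h2 ?_, hnot⟩
  filter_upwards [h1, h2.eventually (h.isOpen.mem_nhds hz)] with t h3 h4
  rw [h.eq]
  exact ⟨h4, by simpa using h3⟩

theorem isCompact_frontier (hb : Bornology.IsBounded Ω) : IsCompact (frontier Ω) :=
  Metric.isCompact_of_isClosed_isBounded isClosed_frontier
    (hb.closure.subset frontier_subset_closure)

theorem IsDefFn.eventually_frontier (h : IsDefFn Ω V ρ) (hΩ : IsOpen Ω) (hz : z ∈ frontier Ω) :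
    ∀ᶠ w in 𝓝 z, w ∈ V ∧ fderiv ℝ ρ w ≠ 0 ∧ (ρ w = 0 ↔ w ∈ frontier Ω) ∧
      (w ∈ closure Ω ↔ ρ w ≤ 0) := by
  have hV := h.frontier_subset hz
  have hc : ContinuousAt (fderiv ℝ ρ) z :=
    ((h.contDiffAt hV).fderiv_right (m := 0) (by simp)).continuousAt
  filter_upwards [h.isOpen.mem_nhds hV, hc.eventually_ne (h.grad_ne z hz)] with w h1 h2
  have h3 : ρ w = 0 ↔ w ∈ frontier Ω := ⟨fun h0 => h.mem_frontier hΩ h1 h0 h2, h.eq_zero hΩ⟩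
  refine ⟨h1, h2, h3, h.nonpos, fun hle => ?_⟩
  rcases hle.lt_or_eq with h4 | h4
  · exact subset_closure (by rw [h.eq]; exact ⟨h1, h4⟩)
  · exact frontier_subset_closure (h3.1 h4)

end DefiningFunctions

section Barrier

open scoped ContDiff

variable {n : ℕ}

theorem contDiff_normSq {m : WithTop ℕ∞} : ContDiff ℝ m (normSq : ℂ → ℝ) := by
  have : (normSq : ℂ → ℝ) = fun z => reCLM z * reCLM z + imCLM z * imCLM z := by
    funext z; simp [normSq_apply]
  rw [this]
  fun_prop

theorem contDiffAt_cgrad {ρ : (Fin n → ℂ) → ℝ} {z : Fin n → ℂ} (hρ : ContDiffAt ℝ ∞ ρ z) :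
    ContDiffAt ℝ ∞ (cgrad ρ) z :=
  contDiffAt_pi.2 fun j => contDiffAt_dzbar (contDiffAt_cplx hρ) (by simp) j

theorem contDiffAt_gradSq {ρ : (Fin n → ℂ) → ℝ} {z : Fin n → ℂ} (hρ : ContDiffAt ℝ ∞ ρ z) :
    ContDiffAt ℝ ∞ (gradSq ρ) z :=
  ContDiffAt.sum fun k _ => contDiff_normSq.contDiffAt.comp z
    (contDiffAt_dz (contDiffAt_cplx hρ) (by simp) k)

theorem contDiffAt_ofReal {F : Type*} [NormedAddCommGroup F] [NormedSpace ℝ F] {f : F → ℝ} {q : F}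
    (hf : ContDiffAt ℝ ∞ f q) : ContDiffAt ℝ ∞ (fun x => (f x : ℂ)) q :=
  ofRealCLM.contDiff.contDiffAt.comp q hf

theorem contDiffAt_tproj {F : Type*} [NormedAddCommGroup F] [NormedSpace ℝ F]
    {ρ : (Fin n → ℂ) → ℝ} {Y ζ : F → Fin n → ℂ} {q : F} (hρ : ContDiffAt ℝ ∞ ρ (ζ q))
    (hY : ContDiffAt ℝ ∞ Y q) (hζ : ContDiffAt ℝ ∞ ζ q) :
    ContDiffAt ℝ ∞ (fun x => tproj ρ (Y x) (ζ x)) q := by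
  have h1 := contDiffAt_ofReal ((contDiffAt_gradSq hρ).comp q hζ)
  have h2 := (contDiffAt_cgrad hρ).comp q hζ
  have h3 := contDiffAt_dirDeriv (contDiffAt_cplx hρ) hY hζ
  exact (h1.smul hY).sub (h3.smul h2)

theorem contDiffAt_re {F : Type*} [NormedAddCommGroup F] [NormedSpace ℝ F] {f : F → ℂ} {q : F}
    (hf : ContDiffAt ℝ ∞ f q) : ContDiffAt ℝ ∞ (fun x => (f x).re) q :=
  reCLM.contDiff.contDiffAt.comp q hf

theorem contDiffAt_coefA {η : ℝ} {ρ ψ : (Fin n → ℂ) → ℝ} {z : Fin n → ℂ}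
    (hρ : ContDiffAt ℝ ∞ ρ z) (hψ : ContDiffAt ℝ ∞ ψ z) :
    ContDiffAt ℝ ∞ (coefA η ρ ψ) z := by
  have h1 := contDiffAt_cgrad hρ
  have h2 := contDiffAt_gradSq hρ
  have h3 := contDiffAt_re (contDiffAt_levi hρ h1 h1 contDiffAt_id)
  have h4 := contDiffAt_re (contDiffAt_levi hψ h1 h1 contDiffAt_id)
  have h5 := contDiffAt_dirDeriv (contDiffAt_cplx hψ) h1 contDiffAt_id
  have h6 : ContDiffAt ℝ ∞ (fun z => normSq (gradSq ρ z +
      ρ z * dirDeriv (cgrad ρ z) (cplx ψ) z)) z :=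
    contDiff_normSq.contDiffAt.comp z
      ((contDiffAt_ofReal h2).add ((contDiffAt_ofReal hρ).mul h5))
  exact (((hρ.mul h3).sub (h2.pow 2)).add ((hρ.pow 2).mul h4)).add (contDiffAt_const.mul h6)

theorem contDiffAt_coefB {F : Type*} [NormedAddCommGroup F] [NormedSpace ℝ F] {η : ℝ}
    {ρ ψ : (Fin n → ℂ) → ℝ} {M ζ : F → Fin n → ℂ} {q : F} (hρ : ContDiffAt ℝ ∞ ρ (ζ q))
    (hψ : ContDiffAt ℝ ∞ ψ (ζ q)) (hM : ContDiffAt ℝ ∞ M q) (hζ : ContDiffAt ℝ ∞ ζ q) :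
    ContDiffAt ℝ ∞ (fun x => coefB η ρ ψ (M x) (ζ x)) q := by
  have hg : ContDiffAt ℝ ∞ (fun x => cgrad ρ (ζ x)) q := (contDiffAt_cgrad hρ).comp q hζ
  have hs : ContDiffAt ℝ ∞ (fun x => ((gradSq ρ (ζ x) : ℝ) : ℂ)) q :=
    contDiffAt_ofReal ((contDiffAt_gradSq hρ).comp q hζ)
  have hr : ContDiffAt ℝ ∞ (fun x => ((ρ (ζ x) : ℝ) : ℂ)) q := contDiffAt_ofReal (hρ.comp q hζ)
  have h1 : ContDiffAt ℝ ∞ (fun x => (gradSq ρ (ζ x) : ℂ) +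
      ρ (ζ x) * dirDeriv (cgrad ρ (ζ x)) (cplx ψ) (ζ x)) q :=
    hs.add (hr.mul (contDiffAt_dirDeriv (contDiffAt_cplx hψ) hg hζ))
  have h2 : ContDiffAt ℝ ∞ (fun x => (starRingEnd ℂ) ((gradSq ρ (ζ x) : ℂ) +
      ρ (ζ x) * dirDeriv (cgrad ρ (ζ x)) (cplx ψ) (ζ x))) q :=
    conjCLE.contDiff.contDiffAt.comp q h1
  exact ((contDiffAt_levi hρ hM hg hζ).add (hr.mul (contDiffAt_levi hψ hM hg hζ))).add
    ((contDiffAt_const.mul h2).mul (contDiffAt_dirDeriv (contDiffAt_cplx hψ) hM hζ))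

theorem contDiffAt_coefC {F : Type*} [NormedAddCommGroup F] [NormedSpace ℝ F] {η : ℝ}
    {ψ : (Fin n → ℂ) → ℝ} {M ζ : F → Fin n → ℂ} {q : F} (hψ : ContDiffAt ℝ ∞ ψ (ζ q))
    (hM : ContDiffAt ℝ ∞ M q) (hζ : ContDiffAt ℝ ∞ ζ q) :
    ContDiffAt ℝ ∞ (fun x => coefC η ψ (M x) (ζ x)) q :=
  (contDiffAt_re (contDiffAt_levi hψ hM hM hζ)).add (contDiffAt_const.mul
    (contDiff_normSq.contDiffAt.comp q (contDiffAt_dirDeriv (contDiffAt_cplx hψ) hM hζ)))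

theorem contDiffAt_barrier {F : Type*} [NormedAddCommGroup F] [NormedSpace ℝ F] {η : ℝ}
    {ρ ψ : (Fin n → ℂ) → ℝ} {Y ζ : F → Fin n → ℂ} {q : F} (hρ : ContDiffAt ℝ ∞ ρ (ζ q))
    (hψ : ContDiffAt ℝ ∞ ψ (ζ q)) (hY : ContDiffAt ℝ ∞ Y q) (hζ : ContDiffAt ℝ ∞ ζ q)
    (hA : coefA η ρ ψ (ζ q) ≠ 0) :
    ContDiffAt ℝ ∞ (fun x => (levi ρ (tproj ρ (Y x) (ζ x)) (tproj ρ (Y x) (ζ x)) (ζ x)).re) q ∧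
      ContDiffAt ℝ ∞ (fun x => coefC η ψ (tproj ρ (Y x) (ζ x)) (ζ x) -
        normSq (coefB η ρ ψ (tproj ρ (Y x) (ζ x)) (ζ x)) / coefA η ρ ψ (ζ x)) q := by
  have hM := contDiffAt_tproj hρ hY hζ
  have hA' : ContDiffAt ℝ ∞ (fun x => coefA η ρ ψ (ζ x)) q := (contDiffAt_coefA hρ hψ).comp q hζ
  exact ⟨contDiffAt_re (contDiffAt_levi hρ hM hM hζ), (contDiffAt_coefC hψ hM hζ).sub
    (ContDiffAt.div (contDiff_normSq.contDiffAt.comp q (contDiffAt_coefB hρ hψ hM hζ)) hA' hA)⟩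

/-- At a boundary point, the inequality defining `etaPsiSet` is a condition on the first-order
behaviour of the barrier. -/
theorem etaPsi_form_eq {η : ℝ} {ρ ψ : (Fin n → ℂ) → ℝ} {L : (Fin n → ℂ) → Fin n → ℂ}
    {p : Fin n → ℂ} (hη : 1 < η) (hρ : ContDiffAt ℝ ∞ ρ p) (hp : ρ p = 0)
    (hd : fderiv ℝ ρ p ≠ 0) (hL : ContDiffAt ℝ ∞ L p) :
    (1 / (η - 1) + 1) *
          normSq (levi ρ (L p) (nfield ρ p) p / (gradNorm ρ p : ℂ) +
            1 / 2 * dirDeriv (L p) (cplx ψ) p) -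
        (normSq (levi ρ (L p) (nfield ρ p) p) / (gradNorm ρ p) ^ 2 +
          1 / 2 * (fieldDeriv (nfield ρ) (fun w => levi ρ (L w) (L w) w) p).re /
            gradNorm ρ p) -
        1 / 4 * (levi ψ (L p) (L p) p).re =
      -(1 / 4) * (fderiv ℝ (fun w => (levi ρ (L w) (L w) w).re) p (cgrad ρ p) /
          (2 * gradSq ρ p) +
        (coefC η ψ (L p) p - normSq (coefB η ρ ψ (L p) p) / coefA η ρ ψ p)) := by
  have hρd : DifferentiableAt ℝ ρ p := hρ.differentiableAt (by simp)
  have hs := gradSq_pos hρd hd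
  have hG : ContDiffAt ℝ ∞ (fun w => (levi ρ (L w) (L w) w).re) p :=
    contDiffAt_re (contDiffAt_levi hρ hL hL contDiffAt_id)
  have hev : (fun w => levi ρ (L w) (L w) w) =ᶠ[𝓝 p]
      cplx fun w => (levi ρ (L w) (L w) w).re := by
    filter_upwards [(hρ.of_le (m := 2) ENat.LEInfty.out).eventually (by simp)] with w hw
    exact Complex.ext rfl (by simpa [cplx] using levi_self_im hw (L w))
  have hN : (fieldDeriv (nfield ρ) (fun w => levi ρ (L w) (L w) w) p).re =
      fderiv ℝ (fun w => (levi ρ (L w) (L w) w).re) p (cgrad ρ p) / (2 * √(gradSq ρ p)) := by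
    rw [← re_dirDeriv_cplx (hG.differentiableAt (by simp)), fieldDeriv, dirDeriv_congr hev,
      nfield_eq, dirDeriv_smul, ← ofReal_inv, re_ofReal_mul]
    have := Real.sqrt_pos.2 hs
    field_simp
  have hB : levi ρ (L p) (nfield ρ p) p = ((√(gradSq ρ p))⁻¹ : ℝ) * levi ρ (L p) (cgrad ρ p) p := by
    rw [nfield_eq, levi_smul_right, ← ofReal_inv, conj_ofReal]
  have hsq : √(gradSq ρ p) ^ 2 = gradSq ρ p := Real.sq_sqrt hs.le
  have hsp := Real.sqrt_pos.2 hs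
  rw [hN, hB, gradNorm_eq hρd, coefA_of_eq_zero hp, coefB_of_eq_zero hp, coefC]
  have := complete_square (κ := fderiv ℝ (fun w => (levi ρ (L w) (L w) w).re) p (cgrad ρ p) /
          (2 * gradSq ρ p)) (l := (levi ψ (L p) (L p) p).re) hη hs (levi ρ (L p) (cgrad ρ p) p)
          (dirDeriv (L p) (cplx ψ) p)
  rw [← add_sub_assoc, this]
  generalize √(gradSq ρ p) = r at *
  rw [← hsq]
  have hr : (r : ℂ) ≠ 0 := ofReal_ne_zero.2 hsp.ne'
  have e1 : (r⁻¹ : ℝ) * levi ρ (L p) (cgrad ρ p) p / ((2 * r : ℝ) : ℂ) =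
      levi ρ (L p) (cgrad ρ p) p / (2 * ((r ^ 2 : ℝ) : ℂ)) := by
    push_cast; field_simp
  rw [e1, normSq_mul, normSq_ofReal]
  field_simp
  ring

theorem fderiv_prodMk_left {E F : Type*} [NormedAddCommGroup E] [NormedSpace ℝ E]
    [NormedAddCommGroup F] [NormedSpace ℝ F] {h : E × F → ℝ} {p : E} {y : F}
    (hh : DifferentiableAt ℝ h (p, y)) (v : E) :
    fderiv ℝ h (p, y) (v, 0) = fderiv ℝ (fun z => h (z, y)) p v := by
  have := hh.hasFDerivAt.comp p (hasFDerivAt_prodMk_left (𝕜 := ℝ) p y)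
  have e : fderiv ℝ (fun z => h (z, y)) p = _ := this.fderiv
  rw [e]
  simp

theorem eventually_barrier_pos {η : ℝ} {ρ ψ : (Fin n → ℂ) → ℝ} {p Y : Fin n → ℂ} (hη : 1 < η)
    (hρ : ContDiffAt ℝ ∞ ρ p) (hψ : ContDiffAt ℝ ∞ ψ p) (hp : ρ p = 0) (hd : fderiv ℝ ρ p ≠ 0)
    (hpsc : ∀ᶠ z in 𝓝 p, ρ z = 0 → LeviPseudoconvexAt ρ z)
    (hpos : levi ρ (tproj ρ Y p) (tproj ρ Y p) p = 0 →
      0 < fderiv ℝ (fun w => (levi ρ (tproj ρ Y w) (tproj ρ Y w) w).re) p (cgrad ρ p) /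
          (2 * gradSq ρ p) +
        (coefC η ψ (tproj ρ Y p) p - normSq (coefB η ρ ψ (tproj ρ Y p) p) / coefA η ρ ψ p)) :
    ∀ᶠ q in 𝓝 (p, Y), 0 < ρ q.1 → 0 < barrier η ρ ψ q.2 q.1 := by
  have hρd : DifferentiableAt ℝ ρ p := hρ.differentiableAt (by simp)
  have hs := gradSq_pos hρd hd
  have hA : coefA η ρ ψ p ≠ 0 := by
    rw [coefA_of_eq_zero hp]
    have : 0 < η - 1 := by linarith
    positivity
  obtain ⟨h1, h2⟩ := contDiffAt_barrier (F := (Fin n → ℂ) × (Fin n → ℂ)) (Y := Prod.snd)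
    (ζ := Prod.fst) (q := (p, Y)) (η := η) hρ hψ contDiffAt_snd contDiffAt_fst hA
  have hr : ContDiffAt ℝ ∞ (fun q : (Fin n → ℂ) × (Fin n → ℂ) => ρ q.1) (p, Y) :=
    ContDiffAt.comp (p, Y) hρ contDiffAt_fst
  have hh : ContDiffAt ℝ ∞ (fun q : (Fin n → ℂ) × (Fin n → ℂ) => barrier η ρ ψ q.2 q.1) (p, Y) :=
    h1.add (hr.mul h2)
  have hbp : ∀ z Y, ρ z = 0 → barrier η ρ ψ Y z =
      (levi ρ (tproj ρ Y z) (tproj ρ Y z) z).re := fun z Y hz => by simp [barrier, hz]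
  by_cases h0 : levi ρ (tproj ρ Y p) (tproj ρ Y p) p = 0
  · have hh1 : ContDiffAt ℝ 1 (fun q : (Fin n → ℂ) × (Fin n → ℂ) => barrier η ρ ψ q.2 q.1)
        (p, Y) := hh.of_le ENat.LEInfty.out
    have hr1 : ContDiffAt ℝ 1 (fun q : (Fin n → ℂ) × (Fin n → ℂ) => ρ q.1) (p, Y) :=
      hr.of_le ENat.LEInfty.out
    refine eventually_pos_of_fderiv_pos (p := (p, Y)) (v := (cgrad ρ p, 0)) hh1 hr1 hp ?_ ?_ ?_
    · rw [fderiv_prodMk_left (hr.differentiableAt (by simp)), fderiv_cgrad hρd]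
      positivity
    · obtain ⟨h3, h4⟩ := contDiffAt_barrier (Y := fun _ => Y) (ζ := fun z => z) (q := p) (η := η)
        hρ hψ contDiffAt_const contDiffAt_id hA
      have h6 := congrArg (fun T => T (cgrad ρ p))
        ((h3.differentiableAt (by simp)).hasFDerivAt.add
          (hρd.hasFDerivAt.mul (h4.differentiableAt (by simp)).hasFDerivAt)).fderiv
      simp only [add_apply, smul_apply, hp, zero_smul,
        zero_add, fderiv_cgrad hρd, smul_eq_mul] at h6
      rw [fderiv_prodMk_left (hh.differentiableAt (by simp))]
      refine lt_of_lt_of_eq ?_ h6.symm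
      have h7 := mul_pos (mul_pos two_pos hs) (hpos h0)
      have h8 : 2 * gradSq ρ p ≠ 0 := by positivity
      rw [mul_add, mul_div_cancel₀ _ h8] at h7
      linarith
    · have hd' : ∀ᶠ z in 𝓝 p, DifferentiableAt ℝ ρ z :=
        ((hρ.of_le (m := 1) ENat.LEInfty.out).eventually
          (by simp)).mono fun z hz => hz.differentiableAt (by simp)
      filter_upwards [continuousAt_fst.eventually (p := fun z => ρ z = 0 → LeviPseudoconvexAt ρ z)
        hpsc, continuousAt_fst.eventually (p := fun z => DifferentiableAt ℝ ρ z) hd']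
        with q hq hq1 hq0
      rw [hbp _ _ hq0]
      exact hq hq0 _ (dirDeriv_tproj hq1 _)
  · have hpp : 0 < barrier η ρ ψ Y p := by
      rw [hbp p Y hp]
      refine lt_of_le_of_ne (hpsc.self_of_nhds hp _ (dirDeriv_tproj hρd Y)) fun h => h0 ?_
      exact Complex.ext h.symm (levi_self_im (hρ.of_le ENat.LEInfty.out) _)
    filter_upwards [hh.continuousAt.eventually (lt_mem_nhds hpp)] with q hq _
    exact hq

end Barrier

section Positivity

open scoped ContDiff

variable {n : ℕ}

theorem logLevi_smul (η : ℝ) (ρ ψ : (Fin n → ℂ) → ℝ) (c : ℂ) (X z : Fin n → ℂ) :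
    logLevi η ρ ψ (c • X) z = normSq c * logLevi η ρ ψ X z := by
  have h : ∀ f : (Fin n → ℂ) → ℝ,
      (levi f (c • X) (c • X) z).re = normSq c * (levi f X X z).re := fun f => by
    rw [levi_smul_left, levi_smul_right, ← mul_assoc, mul_conj, re_ofReal_mul]
  rw [logLevi, h, h, dirDeriv_smul, dirDeriv_smul, mul_div_assoc c, ← mul_add, normSq_mul,
    normSq_mul, logLevi]
  ring

theorem logLevi_pos {η : ℝ} {ρ ψ : (Fin n → ℂ) → ℝ} {z X : Fin n → ℂ}
    (hρ : ContDiffAt ℝ 2 ρ z) (hψ : ContDiffAt ℝ 2 ψ z) (hz : 0 < ρ z) (hs : 0 < gradSq ρ z)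
    (hA : 0 < coefA η ρ ψ z)
    (hb : ∀ Y, ‖Y‖ = 1 → dirDeriv Y (cplx ρ) z = 0 → 0 < barrier η ρ ψ Y z) (hX : X ≠ 0) :
    0 < logLevi η ρ ψ X z := by
  have hz' : (ρ z : ℂ) ≠ 0 := ofReal_ne_zero.2 hz.ne'
  set s := gradSq ρ z with hsdef
  set c := dirDeriv X (cplx ρ) z / ρ z with hc
  have hT := dirDeriv_tproj (hρ.differentiableAt (by simp)) X
  have hsX : (s : ℂ) • X = tproj ρ X z + (c * ρ z) • cgrad ρ z := by
    rw [tproj, hc, div_mul_cancel₀ _ hz']; abel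
  suffices h : ∃ a : ℂ, 0 < logLevi η ρ ψ (a • X) z by
    obtain ⟨a, ha⟩ := h
    rw [logLevi_smul] at ha
    exact pos_of_mul_pos_right ha (normSq_nonneg _)
  by_cases hY : tproj ρ X z = 0
  · refine ⟨s, ?_⟩
    have h0 : ∀ (f : (Fin n → ℂ) → ℝ) Y, levi f 0 Y z = 0 := fun f Y => by simp [levi]
    rw [hsX, hY, logLevi_add_smul_cgrad hρ hψ hz (by simp [dirDeriv])]
    have hB : coefB η ρ ψ 0 z = 0 := by simp [coefB, h0, dirDeriv]
    have hC : coefC η ψ 0 z = 0 := by simp [coefC, h0, dirDeriv]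
    have hc0 : c ≠ 0 := by
      rintro h
      rw [h, hY, zero_mul, zero_smul, add_zero, smul_eq_zero, ofReal_eq_zero] at hsX
      exact hsX.elim hs.ne' hX
    have := normSq_pos.2 hc0
    rw [hB, hC, h0]
    simp only [zero_re, zero_div, mul_zero, zero_add, add_zero]
    positivity
  · set r := ‖tproj ρ X z‖ with hr
    have hr0 : 0 < r := norm_pos_iff.2 hY
    have hr0' : (r : ℂ) ≠ 0 := ofReal_ne_zero.2 hr0.ne'
    set u := (r : ℂ)⁻¹ • tproj ρ X z with hu
    have hu1 : ‖u‖ = 1 := by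
      rw [hu, norm_smul, norm_inv, norm_real, Real.norm_of_nonneg hr0.le, ← hr,
        inv_mul_cancel₀ hr0.ne']
    have hut : dirDeriv u (cplx ρ) z = 0 := by rw [hu, dirDeriv_smul, hT, mul_zero]
    refine ⟨s / r * s, ?_⟩
    have e : (s / r * s : ℂ) • X = tproj ρ u z + ((s / r * c) * ρ z) • cgrad ρ z := by
      rw [tproj_of_tangent hut, mul_smul, hsX, smul_add, hu, smul_smul, smul_smul, ← hsdef,
        div_eq_mul_inv, mul_assoc (_ * _)]
    rw [e, logLevi_add_smul_cgrad hρ hψ hz (dirDeriv_tproj (hρ.differentiableAt (by simp)) u)]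
    have hbar := div_pos (hb u hu1 hut) hz
    rw [barrier, add_div, mul_div_cancel_left₀ _ hz.ne'] at hbar
    have := quadratic_ge hA (coefB η ρ ψ (tproj ρ u z) z) (s / r * c)
    linarith

theorem exists_strictPSHOn {η : ℝ} {Ω V : Set (Fin n → ℂ)} {ρ ψ : (Fin n → ℂ) → ℝ} (hη : 1 < η)
    (hΩ : IsOpen Ω) (hbd : Bornology.IsBounded Ω) (hdef : IsDefFn Ω V ρ)
    (hpsc : ∀ q ∈ frontier Ω, LeviPseudoconvexAt ρ q) (hψ : ContDiff ℝ ∞ ψ)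
    (hpos : ∀ p ∈ frontier Ω, ∀ Y : Fin n → ℂ, tproj ρ Y p ≠ 0 →
      levi ρ (tproj ρ Y p) (tproj ρ Y p) p = 0 →
      0 < fderiv ℝ (fun w => (levi ρ (tproj ρ Y w) (tproj ρ Y w) w).re) p (cgrad ρ p) /
          (2 * gradSq ρ p) +
        (coefC η ψ (tproj ρ Y p) p - normSq (coefB η ρ ψ (tproj ρ Y p) p) / coefA η ρ ψ p)) :
    ∃ W : Set (Fin n → ℂ), IsOpen W ∧ frontier Ω ⊆ W ∧
      StrictPSHOn (fun z => (ρ z * Real.exp (ψ z)) ^ η) ((closure Ω)ᶜ ∩ W) := by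
  have hη' : 0 < η - 1 := by linarith
  have hloc : ∀ q ∈ frontier Ω ×ˢ Metric.sphere (0 : Fin n → ℂ) 1, ∀ᶠ x in 𝓝 q,
      dirDeriv x.2 (cplx ρ) x.1 = 0 → 0 < ρ x.1 → 0 < barrier η ρ ψ x.2 x.1 := by
    rintro ⟨p, Y⟩ ⟨hp, hY⟩
    have hY : ‖Y‖ = 1 := by simpa using hY
    have hp : p ∈ frontier Ω := hp
    have hρ := hdef.contDiffAt (hdef.frontier_subset hp)
    have hd := hdef.grad_ne p hp
    by_cases ht : dirDeriv Y (cplx ρ) p = 0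
    · refine (eventually_barrier_pos hη hρ hψ.contDiffAt (hdef.eq_zero hΩ hp) hd ?_
        (hpos p hp Y ?_)).mono fun x hx _ => hx
      · filter_upwards [hdef.eventually_frontier hΩ hp] with z hz hz0
        exact hpsc z (hz.2.2.1.1 hz0)
      · rw [tproj_of_tangent ht, Ne, smul_eq_zero, ofReal_eq_zero, not_or]
        exact ⟨(gradSq_pos (hρ.differentiableAt (by simp)) hd).ne', by
          rintro rfl; simp at hY⟩
    · have hc : ContinuousAt (fun x : (Fin n → ℂ) × (Fin n → ℂ) => dirDeriv x.2 (cplx ρ) x.1)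
          (p, Y) := (contDiffAt_dirDeriv (X := Prod.snd) (ζ := Prod.fst) (q := (p, Y))
            (contDiffAt_cplx hρ) contDiffAt_snd contDiffAt_fst).continuousAt
      exact (hc.eventually_ne ht).mono fun x h1 h2 => absurd h2 h1
  obtain ⟨S, hS, hST⟩ : ∃ S ∈ 𝓝ˢ (frontier Ω), ∀ z ∈ S, ∀ Y : Fin n → ℂ, ‖Y‖ = 1 →
      dirDeriv Y (cplx ρ) z = 0 → 0 < ρ z → 0 < barrier η ρ ψ Y z := by
    have hprod := eventually_nhdsSet_iff_forall.2 hloc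
    rw [(isCompact_frontier hbd).nhdsSet_prod_eq (isCompact_sphere _ _)] at hprod
    obtain ⟨S, hS, T, hT, hST⟩ := Filter.mem_prod_iff.1 hprod
    exact ⟨S, hS, fun z hz Y hY => hST (Set.mk_mem_prod hz
      (subset_of_mem_nhdsSet hT (by simpa using hY)))⟩
  have hnear : ∀ᶠ z in 𝓝ˢ (frontier Ω), z ∈ V ∧ (z ∈ closure Ω ↔ ρ z ≤ 0) ∧
      0 < gradSq ρ z ∧ 0 < coefA η ρ ψ z := by
    refine eventually_nhdsSet_iff_forall.2 fun p hp => ?_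
    have hρ := hdef.contDiffAt (hdef.frontier_subset hp)
    have hs := gradSq_pos (hρ.differentiableAt (by simp)) (hdef.grad_ne p hp)
    have hA : 0 < coefA η ρ ψ p := by
      rw [coefA_of_eq_zero (hdef.eq_zero hΩ hp)]
      positivity
    filter_upwards [hdef.eventually_frontier hΩ hp,
      (contDiffAt_gradSq hρ).continuousAt.eventually (lt_mem_nhds hs),
      (contDiffAt_coefA hρ hψ.contDiffAt).continuousAt.eventually (lt_mem_nhds hA)] with z h1 h2 h3
    exact ⟨h1.1, h1.2.2.2, h2, h3⟩
  obtain ⟨W, hW, hKW, hWsub⟩ := mem_nhdsSet_iff_exists.1 (Filter.inter_mem hnear hS)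
  refine ⟨W, hW, hKW, fun z hz X hX => ?_⟩
  obtain ⟨⟨hzV, hcl, hs, hA⟩, hzS⟩ := hWsub hz.2
  have hρz : 0 < ρ z := not_le.1 fun h => hz.1 (hcl.2 h)
  have hρ2 : ContDiffAt ℝ 2 ρ z := (hdef.contDiffAt hzV).of_le ENat.LEInfty.out
  have hψ2 : ContDiffAt ℝ 2 ψ z := hψ.contDiffAt.of_le ENat.LEInfty.out
  rw [levi_rpow_mul_exp hρ2 hψ2 hρz (Filter.EventuallyEq.refl _ _) X]
  have hlog : 0 < logLevi η ρ ψ X z := logLevi_pos hρ2 hψ2 hρz hs hA (fun Y hY hYt =>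
    hST z hzS Y hY hYt hρz) hX
  have := Real.exp_pos (ψ z)
  positivity

theorem fderiv_enormSq (z v : Fin n → ℂ) :
    fderiv ℝ (enormSq : (Fin n → ℂ) → ℝ) z v =
      ∑ j, 2 * ((z j).re * (v j).re + (z j).im * (v j).im) := by
  have h1 : ∀ j, HasFDerivAt (fun z : Fin n → ℂ => (z j).re)
      (reCLM.comp (ContinuousLinearMap.proj j)) z := fun j =>
    (reCLM.comp (ContinuousLinearMap.proj (R := ℝ) (φ := fun _ : Fin n => ℂ) j)).hasFDerivAt
  have h2 : ∀ j, HasFDerivAt (fun z : Fin n → ℂ => (z j).im)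
      (imCLM.comp (ContinuousLinearMap.proj j)) z := fun j =>
    (imCLM.comp (ContinuousLinearMap.proj (R := ℝ) (φ := fun _ : Fin n => ℂ) j)).hasFDerivAt
  have h := HasFDerivAt.fun_sum fun j (_ : j ∈ Finset.univ) =>
    ((h1 j).mul (h1 j)).add ((h2 j).mul (h2 j))
  have e : (enormSq : (Fin n → ℂ) → ℝ) = fun z : Fin n → ℂ =>
      ∑ j, ((z j).re * (z j).re + (z j).im * (z j).im) := by
    funext z; simp [enormSq, normSq_apply]
  have h' : HasFDerivAt (enormSq : (Fin n → ℂ) → ℝ) _ z := e ▸ h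
  rw [h'.fderiv, sum_apply]
  refine Finset.sum_congr rfl fun j _ => ?_
  simp
  ring

theorem contDiff_enormSq {m : WithTop ℕ∞} : ContDiff ℝ m (enormSq : (Fin n → ℂ) → ℝ) :=
  ContDiff.sum fun j _ => contDiff_normSq.comp (contDiff_apply ℝ ℂ j)

theorem dz_enormSq (j : Fin n) (z : Fin n → ℂ) :
    dz j (cplx enormSq) z = (starRingEnd ℂ) (z j) := by
  rw [dz_cplx (contDiff_enormSq (m := 1).differentiable (by simp) _), fderiv_enormSq,
    fderiv_enormSq, Finset.sum_eq_single j, Finset.sum_eq_single j]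
  · apply Complex.ext <;> simp [neg_div]
  all_goals simp +contextual

theorem dirDeriv_enormSq (M z : Fin n → ℂ) :
    dirDeriv M (cplx enormSq) z = ∑ j, M j * (starRingEnd ℂ) (z j) := by
  simp only [dirDeriv, dz_enormSq]

theorem levi_enormSq (M z : Fin n → ℂ) : levi enormSq M M z = enormSq M := by
  have h1 : ∀ k : Fin n, (fun w => dzbar k (cplx enormSq) w) = fun w => w k := fun k => by
    funext w
    rw [← conj_dz_cplx (contDiff_enormSq (m := 1).differentiable (by simp) _), dz_enormSq,
      Complex.conj_conj]
  have h2 : ∀ (j k : Fin n), dz j (fun w : Fin n → ℂ => w k) z = if j = k then 1 else 0 := by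
    intro j k
    have := (ContinuousLinearMap.proj (R := ℝ) (φ := fun _ : Fin n => ℂ) k).hasFDerivAt (x := z)
    have e : fderiv ℝ (fun w : Fin n → ℂ => w k) z = _ := this.fderiv
    rw [dz, e]
    by_cases h : j = k
    · subst h
      simp
    · simp [h, Ne.symm h]
  simp [levi, h1, h2, enormSq, mul_conj]

theorem normSq_dirDeriv_enormSq_le (M z : Fin n → ℂ) :
    normSq (dirDeriv M (cplx enormSq) z) ≤ enormSq z * enormSq M := by
  rw [dirDeriv_enormSq, normSq_eq_norm_sq]
  have h := Finset.sum_mul_sq_le_sq_mul_sq Finset.univ (fun j => ‖M j‖) fun j => ‖z j‖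
  have h1 : ‖∑ j, M j * (starRingEnd ℂ) (z j)‖ ≤ ∑ j, ‖M j‖ * ‖z j‖ :=
    (norm_sum_le _ _).trans_eq (by simp)
  simp only [enormSq, normSq_eq_norm_sq]
  calc _ ≤ (∑ j, ‖M j‖ * ‖z j‖) ^ 2 := by gcongr
    _ ≤ _ := h.trans_eq (mul_comm _ _)

theorem enormSq_pos {M : Fin n → ℂ} (hM : M ≠ 0) : 0 < enormSq M := by
  obtain ⟨j, hj⟩ := Function.ne_iff.1 hM
  exact Finset.sum_pos' (fun _ _ => normSq_nonneg _) ⟨j, Finset.mem_univ j, normSq_pos.2 hj⟩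

end Positivity

section UpperBound

open scoped ContDiff

variable {n : ℕ}

theorem IsDefFn.mul_exp {Ω V : Set (Fin n → ℂ)} {ρ ψ : (Fin n → ℂ) → ℝ} (h : IsDefFn Ω V ρ)
    (hΩ : IsOpen Ω) (hψ : ContDiff ℝ ∞ ψ) : IsDefFn Ω V fun z => ρ z * Real.exp (ψ z) where
  isOpen := h.isOpen
  subset := h.subset
  smooth := h.smooth.mul hψ.exp.contDiffOn
  eq := by
    ext z
    rw [h.eq]
    simp [mul_neg_iff, Real.exp_pos, not_lt.2 (Real.exp_pos _).le]
  grad_ne z hz := by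
    have hd := ((h.contDiffAt (h.frontier_subset hz)).differentiableAt (by simp)).hasFDerivAt.mul
      (hψ.differentiable (by simp) z).exp.hasFDerivAt
    have e : fderiv ℝ (fun z => ρ z * Real.exp (ψ z)) z = _ := hd.fderiv
    rw [e, h.eq_zero hΩ hz, zero_smul, zero_add, Ne, smul_eq_zero, not_or]
    exact ⟨(Real.exp_pos _).ne', h.grad_ne z hz⟩

theorem steinIndex_le_of_mem_etaPsiSet {η η' : ℝ} {Ω V U : Set (Fin n → ℂ)}
    {ρ ψ : (Fin n → ℂ) → ℝ} (hΩ : IsOpen Ω) (hbd : Bornology.IsBounded Ω) (hdef : IsDefFn Ω V ρ)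
    (hpsc : ∀ q ∈ frontier Ω, LeviPseudoconvexAt ρ q) (hU : IsOpen U) (hfr : frontier Ω ⊆ U)
    (hUV : U ⊆ V) (hψ : ContDiffOn ℝ ∞ ψ U) (hη : η ∈ etaPsiSet Ω U ρ ψ) (hη' : η < η') :
    steinIndex Ω ≤ ENNReal.ofReal η' := by
  have hψU : ∀ z ∈ U, ContDiffAt ℝ ∞ ψ z := fun z hz => (hψ z hz).contDiffAt (hU.mem_nhds hz)
  obtain ⟨g, hg, hgψ, -⟩ := exists_contDiff_eq_nhdsSet (m := ⊤) isClosed_frontier hU hfr hψU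
  have hgψ' := eventually_nhdsSet_iff_forall.1 hgψ
  obtain ⟨R, hR⟩ := (isCompact_frontier hbd).bddAbove_image
    (contDiff_enormSq (n := n) (m := 0)).continuous.continuousOn
  have h1 : 0 < η - 1 := by linarith [hη.1]
  have h1' : 0 < η' - 1 := by linarith
  obtain ⟨ε, hε, hpert⟩ := exists_perturbation (k := 1 / (η - 1) + 1) (k' := 1 / (η' - 1) + 1)
    (R := R) (by positivity) (by gcongr)
  set ψ' : (Fin n → ℂ) → ℝ := fun z => g z + ε * enormSq z with hψ'
  have hsm : ContDiff ℝ ∞ fun z : Fin n → ℂ => ε * enormSq z :=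
    contDiff_const.mul contDiff_enormSq
  have hψ's : ContDiff ℝ ∞ ψ' := ContDiff.add hg hsm
  obtain ⟨W, hW, hfW, hsp⟩ := exists_strictPSHOn (η := η') (by linarith [hη.1]) hΩ hbd hdef hpsc
    hψ's (by
      intro p hp Y hM h0
      have hρ := hdef.contDiffAt (hdef.frontier_subset hp)
      have hL : IsTangentField ρ (tproj ρ Y) U :=
        ⟨fun z hz => (contDiffAt_tproj (Y := fun _ => Y) (ζ := fun z => z)
          (hdef.contDiffAt (hUV hz)) contDiffAt_const contDiffAt_id).contDiffWithinAt,
        fun z hz => dirDeriv_tproj ((hdef.contDiffAt (hUV hz)).differentiableAt (by simp)) Y⟩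
      have key := hη.2 _ hL p hp h0
      have form := etaPsi_form_eq (η := η') (ψ := ψ') (by linarith) hρ (hdef.eq_zero hΩ hp)
        (hdef.grad_ne p hp) ((hL.1 p (hfr hp)).contDiffAt (hU.mem_nhds (hfr hp)))
      have e1 : dirDeriv (tproj ρ Y p) (cplx ψ') p = dirDeriv (tproj ρ Y p) (cplx ψ) p +
          ε * dirDeriv (tproj ρ Y p) (cplx enormSq) p := by
        rw [hψ', dirDeriv_cplx_add (hg.differentiable (by simp) p)
          (hsm.differentiable (by simp) p), dirDeriv_congr (cplx_congr (hgψ' p hp)),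
          dirDeriv_comp_real (g := fun t => ε * t) (g' := ε)
            (contDiff_enormSq.differentiable one_ne_zero p)
            (by simpa using (hasDerivAt_id _).const_mul ε)]
      have e2 : (levi ψ' (tproj ρ Y p) (tproj ρ Y p) p).re =
          (levi ψ (tproj ρ Y p) (tproj ρ Y p) p).re + ε * enormSq (tproj ρ Y p) := by
        rw [hψ', levi_cplx_add (hg.contDiffAt.of_le ENat.LEInfty.out)
          (hsm.contDiffAt.of_le ENat.LEInfty.out), levi_congr (hgψ' p hp),
          levi_comp_real (g := fun t => ε * t) (g' := fun _ => ε) (g'' := 0)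
            contDiff_enormSq.contDiffAt
            (Filter.Eventually.of_forall fun t => by simpa using (hasDerivAt_id t).const_mul ε)
            (hasDerivAt_const _ _), levi_enormSq]
        simp
      have hlt := hpert (levi ρ (tproj ρ Y p) (nfield ρ p) p / (gradNorm ρ p : ℂ) +
        1 / 2 * dirDeriv (tproj ρ Y p) (cplx ψ) p) (dirDeriv (tproj ρ Y p) (cplx enormSq) p)
        (enormSq (tproj ρ Y p)) (enormSq_pos hM)
        ((normSq_dirDeriv_enormSq_le _ _).trans (mul_le_mul_of_nonneg_right
          (hR (Set.mem_image_of_mem _ hp)) (enormSq_pos hM).le))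
      rw [e1, e2, mul_add, ← add_assoc] at form
      linarith)
  exact iInf_le_of_le V (iInf_le_of_le _ (iInf_le_of_le (hdef.mul_exp hΩ hψ's)
    (sInf_le ⟨η', ⟨by linarith [hη.1], W, hW, hfW, hsp⟩, rfl⟩)))

end UpperBound

section LowerBound

open scoped ContDiff

variable {n : ℕ}

theorem IsDefFn.exists_quotient {Ω V V' : Set (Fin n → ℂ)} {ρ ρ' : (Fin n → ℂ) → ℝ}
    (h : IsDefFn Ω V ρ) (h' : IsDefFn Ω V' ρ') (hΩ : IsOpen Ω) :
    ∃ q : (Fin n → ℂ) → ℝ, ∀ p ∈ frontier Ω, ∀ᶠ z in 𝓝 p,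
      ContDiffAt ℝ ∞ q z ∧ 0 < q z ∧ ρ' z = ρ z * q z := by
  classical
  set q : (Fin n → ℂ) → ℝ := fun z =>
    if ρ z = 0 then fderiv ℝ ρ' z (cgrad ρ z) / fderiv ℝ ρ z (cgrad ρ z) else ρ' z / ρ z with hq
  have key : ∀ p ∈ frontier Ω, ∀ m : ℕ, ∃ H : (Fin n → ℂ) → ℝ, ContDiffAt ℝ m H p ∧
      q =ᶠ[𝓝 p] H ∧ ∀ᶠ z in 𝓝 p, ρ' z = ρ z * H z := by
    intro p hp m
    have hle : ∀ k : ℕ, ((k : WithTop ℕ∞) + 1) ≤ ((⊤ : ℕ∞) : WithTop ℕ∞) := fun k => by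
      exact_mod_cast (le_top : ((k + 1 : ℕ) : ℕ∞) ≤ ⊤)
    obtain ⟨H, hH, hHeq⟩ := exists_contDiffAt_mul_eq (m := m + 1)
      ((h.contDiffAt (h.frontier_subset hp)).of_le (hle _))
      ((h'.contDiffAt (h'.frontier_subset hp)).of_le (hle _)) (h.eq_zero hΩ hp) (h.grad_ne p hp)
      ((h.eventually_frontier hΩ hp).mono fun z hz h0 => h'.eq_zero hΩ (hz.2.2.1.1 h0))
    refine ⟨H, hH.of_le (by simp), ?_, hHeq⟩
    filter_upwards [hHeq.eventually_nhds, hH.eventually (by simp), h.eventually_frontier hΩ hp]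
      with z h1 h2 h3
    have hρd : DifferentiableAt ℝ ρ z := (h.contDiffAt h3.1).differentiableAt (by simp)
    by_cases h0 : ρ z = 0
    · have hd : fderiv ℝ ρ' z = H z • fderiv ℝ ρ z := by
        have h1' : ρ' =ᶠ[𝓝 z] fun w => ρ w * H w := h1
        rw [h1'.fderiv_eq, fderiv_fun_mul hρd (h2.differentiableAt (by simp)), h0, zero_smul,
          zero_add]
      have hne : fderiv ℝ ρ z (cgrad ρ z) ≠ 0 := by
        rw [fderiv_cgrad hρd]
        have := gradSq_pos hρd h3.2.1
        positivity
      simp only [hq, h0, if_true, hd, smul_apply, smul_eq_mul]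
      field_simp
    · simp only [hq, h0, if_false]
      rw [h1.self_of_nhds]
      field_simp
  have hsm : ∀ p ∈ frontier Ω, ContDiffAt ℝ ∞ q p := fun p hp => by
    refine contDiffAt_infty.2 fun m => ?_
    obtain ⟨H, hH, hqH, -⟩ := key p hp m
    exact hH.congr_of_eventuallyEq hqH
  refine ⟨q, fun p hp => ?_⟩
  have hmul : ∀ᶠ z in 𝓝 p, ρ' z = ρ z * q z := by
    obtain ⟨H, -, hqH, hHeq⟩ := key p hp 0
    filter_upwards [hqH, hHeq] with z h1 h2
    rw [h1, h2]
  have hρd : DifferentiableAt ℝ ρ p :=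
    (h.contDiffAt (h.frontier_subset hp)).differentiableAt (by simp)
  have hne : q p ≠ 0 := fun h0 => by
    have hmul' : ρ' =ᶠ[𝓝 p] fun z => ρ z * q z := hmul
    refine h'.grad_ne p hp ?_
    rw [hmul'.fderiv_eq, fderiv_fun_mul hρd ((hsm p hp).differentiableAt (by simp)),
      h.eq_zero hΩ hp, h0, zero_smul, zero_smul, zero_add]
  have hnn : 0 ≤ q p := by
    have hpos := eventually_pos_add_smul (v := cgrad ρ p) hρd (h.eq_zero hΩ hp) (by
      rw [fderiv_cgrad hρd]
      have := gradSq_pos hρd (h.grad_ne p hp)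
      positivity)
    have hlim : Filter.Tendsto (fun t : ℝ => p + t • cgrad ρ p) (𝓝[>] 0) (𝓝 p) := by
      have : Continuous fun t : ℝ => p + t • cgrad ρ p := by fun_prop
      simpa using (this.tendsto 0).mono_left nhdsWithin_le_nhds
    refine ge_of_tendsto ((hsm p hp).continuousAt.tendsto.comp hlim) ?_
    filter_upwards [hpos, hlim.eventually (h.eventually_frontier hΩ hp),
      hlim.eventually (h'.eventually_frontier hΩ hp), hlim.eventually hmul] with t h1 h2 h3 h4
    have h5 : 0 < ρ' (p + t • cgrad ρ p) :=
      not_le.1 fun hle => absurd (h2.2.2.2.1 (h3.2.2.2.2 hle)) (not_le.2 h1)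
    rw [h4] at h5
    exact (pos_of_mul_pos_right h5 h1.le).le
  filter_upwards [(hsm p hp).continuousAt.eventually (lt_mem_nhds (lt_of_le_of_ne hnn hne.symm)),
    hmul, h.eventually_frontier hΩ hp, h'.eventually_frontier hΩ hp] with z h1 h2 h3 h4
  refine ⟨?_, h1, h2⟩
  by_cases h0 : ρ z = 0
  · exact hsm z (h3.2.2.1.1 h0)
  · refine ((h'.contDiffAt h4.1).div (h.contDiffAt h3.1) h0).congr_of_eventuallyEq ?_
    filter_upwards [(h.contDiffAt h3.1).continuousAt.eventually_ne h0] with w hw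
    simp [hq, hw]

theorem IsDefFn.exists_eq_mul_exp {Ω V V' : Set (Fin n → ℂ)} {ρ ρ' : (Fin n → ℂ) → ℝ}
    (h : IsDefFn Ω V ρ) (h' : IsDefFn Ω V' ρ') (hΩ : IsOpen Ω) :
    ∃ ψ : (Fin n → ℂ) → ℝ, ContDiff ℝ ∞ ψ ∧
      ∀ p ∈ frontier Ω, ∀ᶠ z in 𝓝 p, ρ' z = ρ z * Real.exp (ψ z) := by
  obtain ⟨q, hq⟩ := h.exists_quotient h' hΩ
  obtain ⟨S, hS, hKS, hSq⟩ := mem_nhdsSet_iff_exists.1 (eventually_nhdsSet_iff_forall.2 hq)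
  obtain ⟨ψ, hψ, hψeq, -⟩ := exists_contDiff_eq_nhdsSet (m := ⊤) (f := fun z => Real.log (q z))
    isClosed_frontier hS hKS fun z hz => (hSq hz).1.log (hSq hz).2.1.ne'
  refine ⟨ψ, hψ, fun p hp => ?_⟩
  filter_upwards [eventually_nhdsSet_iff_forall.1 hψeq p hp, hq p hp] with z h1 h2
  rw [h1, Real.exp_log h2.2.1, h2.2.2]

theorem mem_etaPsiSet_of_mem_steinExpSet {η : ℝ} {Ω V U : Set (Fin n → ℂ)}
    {ρ ρ' ψ : (Fin n → ℂ) → ℝ} (hΩ : IsOpen Ω) (hdef : IsDefFn Ω V ρ) (hU : IsOpen U)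
    (hfr : frontier Ω ⊆ U) (hψ : ContDiff ℝ ∞ ψ)
    (hρ' : ∀ p ∈ frontier Ω, ∀ᶠ z in 𝓝 p, ρ' z = ρ z * Real.exp (ψ z))
    (hη : η ∈ steinExpSet Ω ρ') : η ∈ etaPsiSet Ω U ρ ψ := by
  obtain ⟨hη1, W, hW, hfW, hsp⟩ := hη
  have hη' : 0 < η - 1 := by linarith
  refine ⟨hη1, fun L hL p hp h0 => ?_⟩
  have hρ := hdef.contDiffAt (hdef.frontier_subset hp)
  have hρd : DifferentiableAt ℝ ρ p := hρ.differentiableAt (by simp)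
  have hd := hdef.grad_ne p hp
  have hs := gradSq_pos hρd hd
  have hρ0 := hdef.eq_zero hΩ hp
  have hLs : ContDiffAt ℝ ∞ L p := (hL.1 p (hfr hp)).contDiffAt (hU.mem_nhds (hfr hp))
  rw [etaPsi_form_eq hη1 hρ hρ0 hd hLs]
  suffices h : 0 ≤ fderiv ℝ (fun w => (levi ρ (L w) (L w) w).re) p (cgrad ρ p) /
      (2 * gradSq ρ p) +
      (coefC η ψ (L p) p - normSq (coefB η ρ ψ (L p) p) / coefA η ρ ψ p) by linarith
  have hA : coefA η ρ ψ p ≠ 0 := by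
    rw [coefA_of_eq_zero hρ0]
    positivity
  set c : ℂ := -coefB η ρ ψ (L p) p / coefA η ρ ψ p with hc
  set Q : (Fin n → ℂ) → ℝ := fun z => coefA η ρ ψ z * normSq c +
    2 * ((starRingEnd ℂ) c * coefB η ρ ψ (L z) z).re + coefC η ψ (L z) z with hQ
  have hQp : Q p = coefC η ψ (L p) p - normSq (coefB η ρ ψ (L p) p) / coefA η ρ ψ p := by
    simp only [hQ, hc, quadratic_min hA]
    ring
  have hQc : ContinuousAt Q p := by
    have h1 := (contDiffAt_coefA (η := η) hρ hψ.contDiffAt).continuousAt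
    have h2 := (contDiffAt_coefB (η := η) (ζ := fun z => z) hρ hψ.contDiffAt hLs
      contDiffAt_id).continuousAt
    have h3 := (contDiffAt_coefC (η := η) (ζ := fun z => z) hψ.contDiffAt hLs
      contDiffAt_id).continuousAt
    exact ((h1.mul continuousAt_const).add (continuousAt_const.mul
      (continuous_re.continuousAt.comp (continuousAt_const.mul h2)))).add h3
  set γ : ℝ → Fin n → ℂ := fun t => p + t • cgrad ρ p with hγ
  have hγ0 : γ 0 = p := by simp [hγ]
  have hγd : HasDerivAt γ (cgrad ρ p) 0 := by
    have h := ((hasDerivAt_id (0 : ℝ)).smul_const (cgrad ρ p)).const_add p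
    rw [one_smul] at h
    exact h
  have hlim : Filter.Tendsto γ (𝓝[>] 0) (𝓝 p) := by
    have := hγd.continuousAt.tendsto
    rw [hγ0] at this
    exact this.mono_left nhdsWithin_le_nhds
  have hslope : ∀ f : (Fin n → ℂ) → ℝ, DifferentiableAt ℝ f p → f p = 0 →
      Filter.Tendsto (fun t => t⁻¹ * f (γ t)) (𝓝[>] 0) (𝓝 (fderiv ℝ f p (cgrad ρ p))) := by
    intro f hf hf0
    have h1 : HasDerivAt (fun t => f (γ t)) (fderiv ℝ f p (cgrad ρ p)) 0 :=
      HasFDerivAt.comp_hasDerivAt (0 : ℝ) (by simpa [hγ0] using hf.hasFDerivAt) hγd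
    refine (h1.tendsto_slope.mono_left (nhdsGT_le_nhdsNE 0)).congr fun t => ?_
    simp [slope_def_field, hγ0, hf0, div_eq_inv_mul]
  have hG : DifferentiableAt ℝ (fun w => (levi ρ (L w) (L w) w).re) p :=
    (contDiffAt_re (contDiffAt_levi hρ hLs hLs contDiffAt_id)).differentiableAt (by simp)
  have hquot : Filter.Tendsto (fun t => (levi ρ (L (γ t)) (L (γ t)) (γ t)).re / ρ (γ t))
      (𝓝[>] 0) (𝓝 (fderiv ℝ (fun w => (levi ρ (L w) (L w) w).re) p (cgrad ρ p) /
        (2 * gradSq ρ p))) := by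
    rw [← fderiv_cgrad hρd]
    refine ((hslope _ hG (by simp [h0])).div (hslope ρ hρd hρ0)
      (by rw [fderiv_cgrad hρd]; positivity)).congr' ?_
    filter_upwards [self_mem_nhdsWithin] with t ht
    exact mul_div_mul_left _ _ (inv_ne_zero (ne_of_gt ht))
  rw [← hQp]
  refine ge_of_tendsto (hquot.add (hQc.tendsto.comp hlim)) ?_
  filter_upwards [eventually_pos_add_smul (v := cgrad ρ p) hρd hρ0
      (by rw [fderiv_cgrad hρd]; positivity),
    hlim.eventually (hdef.eventually_frontier hΩ hp), hlim.eventually (hU.mem_nhds (hfr hp)),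
    hlim.eventually (hW.mem_nhds (hfW hp)), hlim.eventually (hρ' p hp).eventually_nhds]
    with t hpos hev htU htW hteq
  have hpos : 0 < ρ (γ t) := hpos
  have hρ2 : ContDiffAt ℝ 2 ρ (γ t) := (hdef.contDiffAt hev.1).of_le ENat.LEInfty.out
  have hψ2 : ContDiffAt ℝ 2 ψ (γ t) := hψ.contDiffAt.of_le ENat.LEInfty.out
  have hlog := logLevi_add_smul_cgrad (η := η) hρ2 hψ2 hpos (hL.2 _ htU) c
  rw [Function.comp_apply, hQ, ← hlog]
  by_cases hX : L (γ t) + (c * ρ (γ t)) • cgrad ρ (γ t) = 0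
  · rw [hX]
    simp [logLevi, levi, dirDeriv]
  · have hpsh := hsp (γ t) ⟨fun hcl => absurd (hev.2.2.2.1 hcl) (not_le.2 hpos), htW⟩ _ hX
    rw [levi_rpow_mul_exp (η := η) hρ2 hψ2 hpos (hteq.mono fun w hw => by simp only [hw])] at hpsh
    refine (pos_of_mul_pos_right hpsh (mul_nonneg (by linarith) ?_)).le
    rw [hteq.self_of_nhds]
    have := Real.exp_pos (ψ (γ t))
    positivity

end LowerBound

/-- Corollary 3.6: `S(Ω)` equals the infimum of `η_ψ` over all smooth
real-valued functions `ψ` on `U`. -/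
theorem steinIndex_eq_iInf_etaPsi {n : ℕ} (hn : 2 ≤ n) (Ω V : Set (Fin n → ℂ))
    (ρ : (Fin n → ℂ) → ℝ)
    (hΩ : IsOpen Ω) (hbd : Bornology.IsBounded Ω)
    (hdef : IsDefFn Ω V ρ) (hpsc : ∀ q ∈ frontier Ω, LeviPseudoconvexAt ρ q)
    (U : Set (Fin n → ℂ)) (hU : IsOpen U) (hfr : frontier Ω ⊆ U) (hUV : U ⊆ V) :
    steinIndex Ω =
      ⨅ (ψ : (Fin n → ℂ) → ℝ) (_ : ContDiffOn ℝ (⊤ : ℕ∞) ψ U), etaPsi Ω U ρ ψ := by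
  refine le_antisymm (le_iInf₂ fun ψ hψ => le_sInf ?_)
    (le_iInf fun V' => le_iInf fun ρ' => le_iInf fun h' => le_sInf ?_)
  · rintro _ ⟨η, hη, rfl⟩
    refine ENNReal.le_of_forall_pos_le_add fun ε hε _ => ?_
    have hη0 : 0 ≤ η := zero_le_one.trans hη.1.le
    rw [← ENNReal.ofReal_coe_nnreal, ← ENNReal.ofReal_add hη0 ε.coe_nonneg]
    exact steinIndex_le_of_mem_etaPsiSet hΩ hbd hdef hpsc hU hfr hUV hψ hη
      (lt_add_of_pos_right η (NNReal.coe_pos.2 hε))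
  · rintro _ ⟨η, hη, rfl⟩
    obtain ⟨ψ, hψ, hρ'⟩ := hdef.exists_eq_mul_exp h' hΩ
    exact iInf₂_le_of_le ψ hψ.contDiffOn
      (sInf_le ⟨η, mem_etaPsiSet_of_mem_steinExpSet hΩ hdef hU hfr hψ hρ' hη, rfl⟩)
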